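/- Let (W,S) be a finite Coxeter system of rank n, not necessarily irreducible. For each s ∈ S, let h_s be the Coxeter number of the irreducible component of W containing s, i.e., the order of a Coxeter element of the standard parabolic subgroup generated by the connected component of s in the Coxeter graph. Then for every sequence (j₁,…,j_{k+1}) of nonnegative integers summing to n with j_i = 1 for some fixed index i, 2·C_{(j₁,…,j_{k+1})}(W) = ∑_{s∈S} h_s · C_{(j₁,…,ĵ_i,…,j_{k+1})}(W_⟨s⟩), where the hat denotes deletion of the i-th entry. -/

import Mathlib

open scoped BigOperators

section Defs

variable {G : Type*} [Group G]

/-- `t` is a reflection with respect to the generating set `S`: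
a conjugate of an element of `S`. -/
def IsReflectionOf (S : Set G) (t : G) : Prop :=
  ∃ g : G, ∃ s ∈ S, t = g * s * g⁻¹

/-- The absolute length of `w`: the minimal length of a word in the
reflections (conjugates of elements of `S`) whose product is `w`. -/
noncomputable def absLength (S : Set G) (w : G) : ℕ :=
  sInf {k | ∃ l : List G, (∀ t ∈ l, IsReflectionOf S t) ∧ l.length = k ∧ l.prod = w}

/-- The absolute order: `u ≤ v` iff `ℓ_T(u) + ℓ_T(u⁻¹v) = ℓ_T(v)`. -/
def absLe (S : Set G) (u v : G) : Prop :=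
  absLength S u + absLength S (u⁻¹ * v) = absLength S v

/-- `c` is a Coxeter element with respect to the set `S` of simple reflections:
a product of all the elements of `S`, each occurring exactly once, in some order. -/
def IsCoxeterElementOf (S : Set G) (c : G) : Prop :=
  ∃ l : List G, l.Nodup ∧ (∀ x, x ∈ l ↔ x ∈ S) ∧ l.prod = c

/-- The rank-selected multichain count `C_{(j₁,…,j_m)}(W)`: the number of multichains
`x₁ ≤ ⋯ ≤ x_{m-1}` in the interval `[1,c]` of the absolute order whose sequence of
rank jumps (prepending `1` and appending `c`) is given by `j`. -/
noncomputable def chainCount (S : Set G) (c : G) {m : ℕ} (j : Fin m → ℕ) : ℕ :=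
  Nat.card {y : Fin (m + 1) → G //
    y 0 = 1 ∧ y (Fin.last m) = c ∧
    (∀ i, absLe S (y i) c) ∧
    (∀ i : Fin m, absLe S (y i.castSucc) (y i.succ)) ∧
    (∀ i : Fin m, absLength S (y i.succ) = absLength S (y i.castSucc) + j i)}

end Defs

section Cox

variable {B : Type*} {W : Type*} [Group W] {M : CoxeterMatrix B}

/-- The set of simple reflections of a Coxeter system. -/
def simpleSet (cs : CoxeterSystem M W) : Set W := Set.range cs.simple

/-- A Coxeter system is irreducible if its set of simple reflections is nonempty and cannot
be partitioned into two nonempty subsets such that every simple reflection in one commutes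
with every simple reflection in the other. -/
def IsIrreducibleCS (cs : CoxeterSystem M W) : Prop :=
  Nonempty B ∧
    ∀ A : Set B, (∀ a ∈ A, ∀ b ∈ Aᶜ, Commute (cs.simple a) (cs.simple b)) →
      A = ∅ ∨ A = Set.univ

/-- The standard parabolic subgroup `W_⟨s⟩` generated by the simple reflections
other than `cs.simple s`. -/
def parabolic (cs : CoxeterSystem M W) (s : B) : Subgroup W :=
  Subgroup.closure (Set.range cs.simple \ {cs.simple s})

/-- The set of simple reflections of the parabolic subgroup `W_⟨s⟩`, viewed as
elements of that subgroup. -/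
def parabolicGens (cs : CoxeterSystem M W) (s : B) : Set (parabolic cs s) :=
  {x | (x : W) ∈ Set.range cs.simple \ {cs.simple s}}

end Cox

section Components

variable {B : Type*} {W : Type*} [Group W] {M : CoxeterMatrix B}

/-- Adjacency in the Coxeter graph: there is an edge between `a` and `b` when the order
of the product of the corresponding simple reflections is at least 3. -/
def coxAdj (cs : CoxeterSystem M W) (a b : B) : Prop :=
  3 ≤ orderOf (cs.simple a * cs.simple b)

/-- The connected component of `s` in the Coxeter graph. -/
def coxComponent (cs : CoxeterSystem M W) (s : B) : Set B :=
  {b | Relation.ReflTransGen (coxAdj cs) s b}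

/-- The irreducible component of `W` containing the simple reflection `s`: the standard
parabolic subgroup generated by the connected component of `s` in the Coxeter graph. -/
def componentSubgroup (cs : CoxeterSystem M W) (s : B) : Subgroup W :=
  Subgroup.closure (cs.simple '' coxComponent cs s)

/-- The simple reflections of the irreducible component of `W` containing `s`,
viewed as elements of that component. -/
def componentGens (cs : CoxeterSystem M W) (s : B) : Set (componentSubgroup cs s) :=
  {x | (x : W) ∈ cs.simple '' coxComponent cs s}

end Components

set_option linter.unusedSectionVars false

section GeometricRepresentation

variable {B : Type*} [Fintype B] [DecidableEq B]

/-- The Gram matrix `-cos (π / M a b)` of the simple roots. -/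
noncomputable def coxGram (M : CoxeterMatrix B) : Matrix B B ℝ :=
  fun a b => -Real.cos (Real.pi / M a b)

/-- The canonical bilinear form attached to a Coxeter matrix. -/
noncomputable def coxForm (M : CoxeterMatrix B) : LinearMap.BilinForm ℝ (B → ℝ) :=
  Matrix.toBilin' (coxGram M)

/-- The simple root indexed by `a`, a standard basis vector. -/
def simpleRoot (a : B) : B → ℝ := Pi.single a 1

/-- The reflection along the simple root indexed by `a`. -/
noncomputable def geomRefl (M : CoxeterMatrix B) (a : B) : Module.End ℝ (B → ℝ) :=
  LinearMap.id - ((2 : ℝ) • (coxForm M).flip (simpleRoot a)).smulRight (simpleRoot a)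

variable (M : CoxeterMatrix B)

theorem coxGram_self (a : B) : coxGram M a a = 1 := by
  simp [coxGram]

theorem coxGram_comm (a b : B) : coxGram M a b = coxGram M b a := by
  simp [coxGram, M.symmetric a b]

theorem coxForm_simpleRoot (a b : B) :
    coxForm M (simpleRoot a) (simpleRoot b) = coxGram M a b := by
  simp [coxForm, simpleRoot]

theorem coxForm_apply (v w : B → ℝ) :
    coxForm M v w = ∑ a, ∑ b, v a * coxGram M a b * w b := by
  simp [coxForm, Matrix.toBilin'_apply]

theorem coxForm_comm (v w : B → ℝ) : coxForm M v w = coxForm M w v := by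
  rw [coxForm_apply, coxForm_apply, Finset.sum_comm]
  refine Finset.sum_congr rfl fun a _ => Finset.sum_congr rfl fun b _ => ?_
  rw [coxGram_comm M b a]; ring

theorem coxForm_simpleRoot_right (v : B → ℝ) (a : B) :
    coxForm M v (simpleRoot a) = ∑ b, v b * coxGram M b a := by
  rw [coxForm_apply]
  refine Finset.sum_congr rfl fun b _ => ?_
  simp [simpleRoot, Pi.single_apply]

theorem coxForm_eq_sum (v w : B → ℝ) :
    coxForm M v w = ∑ b, w b * coxForm M v (simpleRoot b) := by
  simp_rw [coxForm_simpleRoot_right, Finset.mul_sum]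
  rw [coxForm_apply, Finset.sum_comm]
  exact Finset.sum_congr rfl fun a _ => Finset.sum_congr rfl fun b _ => by ring

theorem geomRefl_apply (a : B) (v : B → ℝ) :
    geomRefl M a v = v - (2 * coxForm M v (simpleRoot a)) • simpleRoot a := by
  simp [geomRefl]

theorem coxForm_geomRefl (a : B) (v w : B → ℝ) :
    coxForm M (geomRefl M a v) (geomRefl M a w) = coxForm M v w := by
  simp only [geomRefl_apply, map_sub, map_smul, LinearMap.sub_apply, LinearMap.smul_apply,
    smul_eq_mul, coxForm_simpleRoot, coxGram_self]
  rw [coxForm_comm M (simpleRoot a) w]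
  ring

theorem geomRefl_geomRefl (a : B) (v : B → ℝ) : geomRefl M a (geomRefl M a v) = v := by
  rw [geomRefl_apply M a (geomRefl M a v)]
  simp only [geomRefl_apply, map_sub, map_smul, LinearMap.sub_apply, LinearMap.smul_apply,
    smul_eq_mul, coxForm_simpleRoot, coxGram_self]
  module

/-- On the plane spanned by two simple roots the vectors `(sin (x + θ), sin x)` are rotated
one step by a simple reflection. -/
theorem geomRefl_sin {a b : B} (x : ℝ) :
    geomRefl M b (Real.sin (x + Real.pi / M a b) • simpleRoot a + Real.sin x • simpleRoot b) =
      Real.sin (x + 2 * (Real.pi / M a b)) • simpleRoot b +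
        Real.sin (x + Real.pi / M a b) • simpleRoot a := by
  simp only [geomRefl_apply, map_add, map_smul, coxForm_simpleRoot, coxGram_self]
  set t := Real.pi / M a b with ht
  have h : coxGram M a b = -Real.cos t := rfl
  have h2 : Real.sin (x + 2 * t) = 2 * Real.cos t * Real.sin (x + t) - Real.sin x := by
    rw [Real.sin_add, Real.sin_add, Real.sin_two_mul, Real.cos_two_mul]; ring
  rw [h, h2]
  module

theorem geomRefl_mul_pow_sin {a b : B} (x : ℝ) (k : ℕ) :
    ((geomRefl M a * geomRefl M b) ^ k)
      (Real.sin (x + Real.pi / M a b) • simpleRoot a + Real.sin x • simpleRoot b) =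
    Real.sin (x + Real.pi / M a b + 2 * k * (Real.pi / M a b)) • simpleRoot a +
      Real.sin (x + 2 * k * (Real.pi / M a b)) • simpleRoot b := by
  induction k with
  | zero => simp
  | succ k ih =>
    rw [pow_succ', Module.End.mul_apply, ih, Module.End.mul_apply]
    have h1 := geomRefl_sin M (a := a) (b := b) (x + 2 * k * (Real.pi / M a b))
    have h2 := geomRefl_sin M (a := b) (b := a) (x + 2 * k * (Real.pi / M a b) + Real.pi / M a b)
    rw [M.symmetric b a] at h2
    rw [show x + Real.pi / M a b + 2 * k * (Real.pi / M a b)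
      = x + 2 * k * (Real.pi / M a b) + Real.pi / M a b by ring, h1,
      show x + 2 * k * (Real.pi / M a b) + 2 * (Real.pi / M a b)
      = x + 2 * k * (Real.pi / M a b) + Real.pi / M a b + Real.pi / M a b by ring, h2]
    push_cast
    congr 2 <;> ring_nf

theorem sin_pi_div_ne_zero {m : ℕ} (hm : 2 ≤ m) : Real.sin (Real.pi / m) ≠ 0 := by
  have hm' : (2 : ℝ) ≤ m := by exact_mod_cast hm
  refine (Real.sin_pos_of_pos_of_lt_pi (by positivity) ?_).ne'
  exact div_lt_self Real.pi_pos (by linarith)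

theorem geomRefl_isLiftable : M.IsLiftable (geomRefl M) := by
  intro a b
  rcases eq_or_ne a b with rfl | hab
  · rw [M.diagonal, pow_one]
    exact LinearMap.ext (geomRefl_geomRefl M a)
  rcases Nat.eq_zero_or_pos (M a b) with h0 | hpos
  · rw [h0, pow_zero]
  have hm : 2 ≤ M a b := by
    have := M.off_diagonal a b hab
    omega
  set m := M a b with hmdef
  set t := Real.pi / (m : ℝ) with ht
  have hsin : Real.sin t ≠ 0 := sin_pi_div_ne_zero hm
  have hmt : 2 * (m : ℝ) * t = 2 * Real.pi := by
    rw [ht]; field_simp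
  set R := geomRefl M a * geomRefl M b with hR
  have key : ∀ x : ℝ, (R ^ m) (Real.sin (x + t) • simpleRoot a + Real.sin x • simpleRoot b) =
      Real.sin (x + t) • simpleRoot a + Real.sin x • simpleRoot b := by
    intro x
    have := geomRefl_mul_pow_sin M (a := a) (b := b) x m
    rw [← hmdef, ← ht, hmt, Real.sin_add_two_pi, Real.sin_add_two_pi] at this
    exact this
  have ha : (R ^ m) (simpleRoot a) = simpleRoot a := by
    have := key 0
    simp only [zero_add, Real.sin_zero, zero_smul, add_zero, map_smul] at this
    exact smul_right_injective _ hsin this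
  have hb : (R ^ m) (simpleRoot b) = simpleRoot b := by
    have := key (-t)
    simp only [neg_add_cancel, Real.sin_zero, zero_smul, zero_add, map_smul] at this
    exact smul_right_injective _ (by simpa using hsin) this
  have hfix : ∀ v, coxForm M v (simpleRoot a) = 0 → coxForm M v (simpleRoot b) = 0 →
      (R ^ m) v = v := by
    intro v hva hvb
    have : R v = v := by
      rw [hR, Module.End.mul_apply, geomRefl_apply M b, hvb]
      simp [geomRefl_apply, hva]
    rw [Module.End.pow_apply]
    exact Function.iterate_fixed this m
  have hg : coxGram M a b = -Real.cos t := rfl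
  have hdet : 1 - Real.cos t ^ 2 ≠ 0 := by
    rw [← Real.sin_sq]; exact pow_ne_zero 2 hsin
  refine LinearMap.ext fun v => ?_
  set p := coxForm M v (simpleRoot a)
  set q := coxForm M v (simpleRoot b)
  set x := (p + Real.cos t * q) / (1 - Real.cos t ^ 2) with hx
  set y := (q + Real.cos t * p) / (1 - Real.cos t ^ 2) with hy
  have e : v = (v - x • simpleRoot a - y • simpleRoot b) + x • simpleRoot a + y • simpleRoot b := by
    module
  have h' := hfix (v - x • simpleRoot a - y • simpleRoot b) (by
      simp only [map_sub, map_smul, LinearMap.sub_apply, LinearMap.smul_apply,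
        smul_eq_mul, coxForm_simpleRoot, coxGram_self, coxGram_comm M b a, hg]
      change p - _ - _ = 0
      rw [hx, hy]; field_simp; ring) (by
      simp only [map_sub, map_smul, LinearMap.sub_apply, LinearMap.smul_apply,
        smul_eq_mul, coxForm_simpleRoot, coxGram_self, hg]
      change q - _ - _ = 0
      rw [hx, hy]; field_simp; ring)
  conv_lhs => rw [e]
  rw [map_add, map_add, map_smul, map_smul, ha, hb, h']
  exact e.symm

variable {M} {W : Type*} [Group W] (cs : CoxeterSystem M W)

/-- The geometric representation of a Coxeter group. -/
noncomputable def geomRep : W →* Module.End ℝ (B → ℝ) :=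
  cs.lift ⟨geomRefl M, geomRefl_isLiftable M⟩

theorem geomRep_simple (a : B) : geomRep cs (cs.simple a) = geomRefl M a :=
  cs.lift_apply_simple (geomRefl_isLiftable M) a

theorem coxForm_geomRep (w : W) (u v : B → ℝ) :
    coxForm M (geomRep cs w u) (geomRep cs w v) = coxForm M u v := by
  induction w using cs.simple_induction_left generalizing u v with
  | one => simp
  | mul_simple_left w i ih =>
    rw [map_mul, Module.End.mul_apply, Module.End.mul_apply, geomRep_simple, coxForm_geomRefl, ih]

theorem geomRep_inv_apply (w : W) (v : B → ℝ) : geomRep cs w⁻¹ (geomRep cs w v) = v := by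
  rw [← Module.End.mul_apply, ← map_mul]; simp

theorem geomRep_apply_inv (w : W) (v : B → ℝ) : geomRep cs w (geomRep cs w⁻¹ v) = v := by
  rw [← Module.End.mul_apply, ← map_mul]; simp

theorem geomRep_injective (w : W) : Function.Injective (geomRep cs w) :=
  Function.LeftInverse.injective (geomRep_inv_apply cs w)

theorem simpleRoot_ne_zero (a : B) : (simpleRoot a : B → ℝ) ≠ 0 := by
  simp [simpleRoot]

/-- For a finite Coxeter group the canonical form is positive definite: averaging an inner product
over the group gives an invariant inner product for which suitably rescaled simple roots
have the same Gram matrix. -/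
theorem coxForm_pos [Finite W] (cs : CoxeterSystem M W) {v : B → ℝ} (hv : v ≠ 0) :
    0 < coxForm M v v := by
  have := Fintype.ofFinite W
  let A : LinearMap.BilinForm ℝ (B → ℝ) :=
    ∑ g : W, (dotProductBilin ℝ ℝ).compl₁₂ (geomRep cs g) (geomRep cs g)
  have hA : ∀ u w, A u w = ∑ g : W, geomRep cs g u ⬝ᵥ geomRep cs g w := by
    intro u w; simp [A]
  have hsymm : ∀ u w, A u w = A w u := by
    intro u w; simp_rw [hA, dotProduct_comm]
  have hinv : ∀ h u w, A (geomRep cs h u) (geomRep cs h w) = A u w := by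
    intro h u w
    rw [hA, hA]
    refine Fintype.sum_equiv (Equiv.mulRight h) _ _ fun g => ?_
    simp [map_mul]
  have hdot : ∀ u : B → ℝ, 0 ≤ u ⬝ᵥ u := fun u =>
    Finset.sum_nonneg fun b _ => mul_self_nonneg (u b)
  have hpos : ∀ u, u ≠ 0 → 0 < A u u := by
    intro u hu
    rw [hA]
    refine Finset.sum_pos' (fun g _ => hdot _) ⟨1, Finset.mem_univ _, ?_⟩
    simpa using lt_of_le_of_ne (hdot u) (Ne.symm (dotProduct_self_eq_zero.not.mpr hu))
  have hroot : ∀ u a, A u (simpleRoot a) = coxForm M u (simpleRoot a) *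
      A (simpleRoot a) (simpleRoot a) := by
    intro u a
    have h1 := hinv (cs.simple a) u (simpleRoot a)
    rw [geomRep_simple, geomRefl_apply, geomRefl_apply, coxForm_simpleRoot, coxGram_self] at h1
    simp only [map_sub, map_smul, LinearMap.sub_apply, LinearMap.smul_apply, smul_eq_mul] at h1
    linarith
  set d : B → ℝ := fun a => A (simpleRoot a) (simpleRoot a) with hd
  have hdpos : ∀ a, 0 < d a := fun a => hpos _ (simpleRoot_ne_zero a)
  have hsq : ∀ a, 0 < √(d a) := fun a => Real.sqrt_pos.mpr (hdpos a)
  have hgram : ∀ a b, A (simpleRoot a) (simpleRoot b) = coxGram M a b * d b := by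
    intro a b; rw [hroot, coxForm_simpleRoot]
  let u : B → ℝ := fun a => v a / √(d a)
  have hu : u ≠ 0 := by
    obtain ⟨a, ha⟩ := Function.ne_iff.mp hv
    exact Function.ne_iff.mpr ⟨a, div_ne_zero ha (hsq a).ne'⟩
  have hexp : ∀ w : B → ℝ, w = ∑ a, w a • simpleRoot a := by
    intro w; ext b; simp [simpleRoot, Pi.single_apply]
  have : A u u = coxForm M v v := by
    rw [coxForm_apply]
    conv_lhs => rw [hexp u]
    simp only [map_sum, map_smul, LinearMap.sum_apply, LinearMap.smul_apply, smul_eq_mul,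
      Finset.mul_sum]
    rw [Finset.sum_comm]
    refine Finset.sum_congr rfl fun a _ => Finset.sum_congr rfl fun b _ => ?_
    rcases eq_or_ne (coxGram M a b) 0 with h0 | h0
    · rw [hgram, h0]; simp
    · have hab : d a = d b := by
        have h1 := hgram a b
        rw [hsymm, hgram b a, coxGram_comm M b a] at h1
        exact mul_left_cancel₀ h0 h1
      rw [hgram]
      simp only [u, hab]
      have := hsq b
      have h2 : √(d b) * √(d b) = d b := Real.mul_self_sqrt (hdpos b).le
      field_simp
      rw [pow_two, h2]
      ring
  rw [← this]
  exact hpos u hu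

theorem coxeterMatrix_ne_zero [Finite W] (cs : CoxeterSystem M W) (a b : B) : M a b ≠ 0 := by
  intro h
  have hab : a ≠ b := by rintro rfl; simp at h
  have hv : (simpleRoot a + simpleRoot b : B → ℝ) ≠ 0 := by
    intro h0
    have := congrFun h0 a
    simp [simpleRoot, hab] at this
  have hp := coxForm_pos cs hv
  simp only [map_add, LinearMap.add_apply, coxForm_simpleRoot, coxGram_self,
    coxGram_comm M b a] at hp
  have : coxGram M a b = -1 := by simp [coxGram, h]
  linarith

theorem two_le_coxeterMatrix [Finite W] (cs : CoxeterSystem M W) {a b : B} (hab : a ≠ b) :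
    2 ≤ M a b := by
  have h0 := coxeterMatrix_ne_zero cs a b
  have h1 := M.off_diagonal a b hab
  omega

theorem coxGram_nonpos [Finite W] (cs : CoxeterSystem M W) {a b : B} (hab : a ≠ b) :
    coxGram M a b ≤ 0 := by
  have hm : (2 : ℝ) ≤ M a b := by exact_mod_cast two_le_coxeterMatrix cs hab
  rw [coxGram, neg_nonpos]
  refine Real.cos_nonneg_of_neg_pi_div_two_le_of_le ?_ ?_
  · have : 0 ≤ Real.pi / M a b := by positivity
    linarith [Real.pi_pos]
  · exact div_le_div_of_nonneg_left Real.pi_pos.le (by norm_num) hm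

theorem geomRep_alternatingWord (k : ℕ) (a b : B) :
    geomRep cs (cs.wordProd (CoxeterSystem.alternatingWord a b k))
      (Real.sin (Real.pi / M a b) • simpleRoot a) =
    Real.sin ((k + 1) * (Real.pi / M a b)) • simpleRoot (if Even k then a else b) +
      Real.sin (k * (Real.pi / M a b)) • simpleRoot (if Even k then b else a) := by
  induction k with
  | zero => simp [CoxeterSystem.alternatingWord]
  | succ k ih =>
    rw [CoxeterSystem.alternatingWord_succ', cs.wordProd_cons, map_mul, Module.End.mul_apply, ih,
      geomRep_simple]
    have h1 := geomRefl_sin M (a := a) (b := b) (k * (Real.pi / M a b))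
    have h2 := geomRefl_sin M (a := b) (b := a) (k * (Real.pi / M a b))
    rw [M.symmetric b a] at h2
    have e1 : ((k : ℝ) + 1) * (Real.pi / M a b) = k * (Real.pi / M a b) + Real.pi / M a b := by ring
    have e2 : (((k + 1 : ℕ) : ℝ) + 1) * (Real.pi / M a b) =
      k * (Real.pi / M a b) + 2 * (Real.pi / M a b) := by push_cast; ring
    have e3 : (((k + 1 : ℕ) : ℝ)) * (Real.pi / M a b) =
      k * (Real.pi / M a b) + Real.pi / M a b := by push_cast; ring
    rw [e1, e2, e3]
    by_cases hk : Even k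
    · have hk' : ¬ Even (k + 1) := by simp [hk, parity_simps]
      simp only [hk, hk', if_true, if_false]
      exact h1
    · have hk' : Even (k + 1) := by simp [hk, parity_simps]
      simp only [hk, hk', if_true, if_false]
      exact h2

/-- If `w` lengthens under right multiplication by a simple reflection, then `w` sends the
corresponding simple root to a nonnegative combination of simple roots. -/
theorem geomRep_simpleRoot_nonneg [Finite W] (w : W) (a : B) (h : ¬ cs.IsRightDescent w a) :
    0 ≤ geomRep cs w (simpleRoot a) := by
  induction hn : cs.length w using Nat.strong_induction_on generalizing w a with
  | _ n ih =>
  rcases eq_or_ne w 1 with rfl | hw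
  · simp [simpleRoot, Pi.single_nonneg]
  obtain ⟨b, hb⟩ := cs.exists_rightDescent_of_ne_one hw
  have hab : a ≠ b := by rintro rfl; exact h hb
  have hm := two_le_coxeterMatrix cs hab
  set u : ℕ → W := fun k => cs.wordProd (CoxeterSystem.alternatingWord a b k) with hu
  have hsucc : ∀ k, u (k + 1) = cs.simple (if Even k then b else a) * u k := by
    intro k
    simp only [hu]
    rw [CoxeterSystem.alternatingWord_succ', cs.wordProd_cons]
  let P : ℕ → Prop := fun k => cs.length (w * (u k)⁻¹) + k = cs.length w
  have hP0 : P 0 := by simp [P, hu, CoxeterSystem.alternatingWord]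
  have hP1 : P 1 := by
    have h1 := cs.isRightDescent_iff.mp hb
    simpa [P, hu, CoxeterSystem.alternatingWord] using h1
  have hPm : ¬ P (M a b) := by
    intro hP
    have hbr : u (M a b) = cs.wordProd (CoxeterSystem.alternatingWord a b (M a b - 1)) *
        cs.simple a := by
      rw [← cs.wordProd_concat, ← CoxeterSystem.alternatingWord_succ]
      have := cs.wordProd_braidWord_eq a b
      rw [CoxeterSystem.braidWord, CoxeterSystem.braidWord, M.symmetric b a] at this
      rw [show M a b - 1 + 1 = M a b by omega]
      exact this
    have e : w * cs.simple a = w * (u (M a b))⁻¹ *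
        cs.wordProd (CoxeterSystem.alternatingWord a b (M a b - 1)) := by
      rw [hbr, mul_inv_rev, cs.inv_simple]; simp [mul_assoc]
    have h1 := cs.length_mul_le (w * (u (M a b))⁻¹)
      (cs.wordProd (CoxeterSystem.alternatingWord a b (M a b - 1)))
    have h2 := cs.length_wordProd_le (CoxeterSystem.alternatingWord a b (M a b - 1))
    rw [CoxeterSystem.length_alternatingWord] at h2
    rw [← e] at h1
    have hP' : cs.length (w * (u (M a b))⁻¹) + M a b = cs.length w := hP
    apply h
    change cs.length (w * cs.simple a) < cs.length w
    omega
  have hex : ∃ k, ¬ P k := ⟨_, hPm⟩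
  classical
  obtain ⟨k, hk⟩ : ∃ k, Nat.find hex = k + 2 := by
    have h2 : Nat.find hex ≠ 0 := fun h' => Nat.find_spec hex (h' ▸ hP0)
    have h3 : Nat.find hex ≠ 1 := fun h' => Nat.find_spec hex (h' ▸ hP1)
    exact ⟨Nat.find hex - 2, by omega⟩
  have hkm : k + 2 ≤ M a b := hk ▸ Nat.find_min' hex hPm
  have hPk : P k := not_not.mp (Nat.find_min hex (by omega))
  have hPk1 : P (k + 1) := not_not.mp (Nat.find_min hex (by omega))
  have hPk2 : ¬ P (k + 2) := hk ▸ Nat.find_spec hex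
  set v := w * (u (k + 1))⁻¹ with hv
  have hwv : w = v * u (k + 1) := by simp [hv]
  have hlen : cs.length v + (k + 1) = cs.length w := hPk1
  have hd1 : ¬ cs.IsRightDescent v (if Even (k + 1) then b else a) := by
    rw [cs.isRightDescent_iff]
    intro h'
    apply hPk2
    change cs.length (w * (u (k + 2))⁻¹) + (k + 2) = _
    rw [hsucc (k + 1), mul_inv_rev, cs.inv_simple, ← mul_assoc, ← hv]
    omega
  have hd2 : ¬ cs.IsRightDescent v (if Even k then b else a) := by
    rw [cs.isRightDescent_iff]
    intro h'
    have : cs.length (w * (u k)⁻¹) + k = _ := hPk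
    have e : v * cs.simple (if Even k then b else a) = w * (u k)⁻¹ := by
      rw [hv, hsucc k, mul_inv_rev, cs.inv_simple]; simp [mul_assoc]
    rw [e] at h'
    omega
  have hda : ¬ cs.IsRightDescent v a ∧ ¬ cs.IsRightDescent v b := by
    by_cases hk : Even k
    · have hk' : ¬ Even (k + 1) := by simp [hk, parity_simps]
      simp only [hk, hk', if_true, if_false] at hd1 hd2
      exact ⟨hd1, hd2⟩
    · have hk' : Even (k + 1) := by simp [hk, parity_simps]
      simp only [hk, hk', if_true, if_false] at hd1 hd2
      exact ⟨hd2, hd1⟩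
  have hva := ih _ (by omega) v a hda.1 rfl
  have hvb := ih _ (by omega) v b hda.2 rfl
  have hsinpos : 0 < Real.sin (Real.pi / M a b) := by
    refine lt_of_le_of_ne (Real.sin_nonneg_of_nonneg_of_le_pi (by positivity) ?_)
      (sin_pi_div_ne_zero hm).symm
    exact div_le_self Real.pi_pos.le (by exact_mod_cast (by omega : 1 ≤ M a b))
  have hsin : ∀ i : ℕ, i ≤ M a b → 0 ≤ Real.sin (i * (Real.pi / M a b)) := by
    intro i hi
    refine Real.sin_nonneg_of_nonneg_of_le_pi (by positivity) ?_
    have : (i : ℝ) ≤ M a b := by exact_mod_cast hi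
    have hM : (0 : ℝ) < M a b := by exact_mod_cast (by omega : 0 < M a b)
    rw [mul_div_assoc', div_le_iff₀ hM]
    nlinarith [Real.pi_pos]
  have key : Real.sin (Real.pi / M a b) • geomRep cs w (simpleRoot a) =
      Real.sin ((k + 2 : ℕ) * (Real.pi / M a b)) •
        geomRep cs v (simpleRoot (if Even (k + 1) then a else b)) +
      Real.sin ((k + 1 : ℕ) * (Real.pi / M a b)) •
        geomRep cs v (simpleRoot (if Even (k + 1) then b else a)) := by
    have := congrArg (geomRep cs v) (geomRep_alternatingWord cs (k + 1) a b)
    rw [← Module.End.mul_apply, ← map_mul, ← hwv, map_smul, map_add, map_smul, map_smul] at this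
    rw [this]
    push_cast
    congr 3
    ring_nf
  have hnn : ∀ c : B, c = a ∨ c = b → 0 ≤ geomRep cs v (simpleRoot c) := by
    rintro c (rfl | rfl) <;> assumption
  have h0 : 0 ≤ Real.sin (Real.pi / M a b) • geomRep cs w (simpleRoot a) := by
    rw [key]
    refine add_nonneg (smul_nonneg (hsin _ (by omega)) (hnn _ ?_))
      (smul_nonneg (hsin _ (by omega)) (hnn _ ?_))
    · split_ifs <;> simp
    · split_ifs <;> simp
  have h1 := smul_nonneg (inv_nonneg.mpr hsinpos.le) h0
  rwa [smul_smul, inv_mul_cancel₀ hsinpos.ne', one_smul] at h1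


theorem geomRep_simpleRoot_nonneg_or_nonpos [Finite W] (w : W) (a : B) :
    0 ≤ geomRep cs w (simpleRoot a) ∨ geomRep cs w (simpleRoot a) ≤ 0 := by
  by_cases h : cs.IsRightDescent w a
  · right
    have := geomRep_simpleRoot_nonneg cs (w * cs.simple a) a
      (cs.isRightDescent_iff_not_isRightDescent_mul.mp h)
    rw [map_mul, Module.End.mul_apply, geomRep_simple, geomRefl_apply, coxForm_simpleRoot,
      coxGram_self, mul_one, two_smul, sub_add_cancel_left, map_neg] at this
    exact neg_nonneg.mp this
  · exact Or.inl (geomRep_simpleRoot_nonneg cs w a h)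

theorem eq_one_of_geomRep_nonneg [Finite W] (w : W)
    (h : ∀ a, 0 ≤ geomRep cs w (simpleRoot a)) : w = 1 := by
  by_contra hw
  obtain ⟨a, ha⟩ := cs.exists_rightDescent_of_ne_one hw
  have := geomRep_simpleRoot_nonneg cs (w * cs.simple a) a
    (cs.isRightDescent_iff_not_isRightDescent_mul.mp ha)
  rw [map_mul, Module.End.mul_apply, geomRep_simple, geomRefl_apply, coxForm_simpleRoot,
    coxGram_self, mul_one, two_smul, sub_add_cancel_left, map_neg] at this
  have h0 : geomRep cs w (simpleRoot a) = 0 := le_antisymm (neg_nonneg.mp this) (h a)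
  exact simpleRoot_ne_zero a (geomRep_injective cs w (by rw [h0, map_zero]))

theorem geomRep_faithful [Finite W] : Function.Injective (geomRep cs) := by
  refine (injective_iff_map_eq_one _).mpr fun w hw => eq_one_of_geomRep_nonneg cs w fun a => ?_
  rw [hw]
  simp [simpleRoot, Pi.single_nonneg]

end GeometricRepresentation

section Roots

variable {B : Type*} [Fintype B] [DecidableEq B] {M : CoxeterMatrix B}
  {W : Type*} [Group W] (cs : CoxeterSystem M W)

/-- `β` is one of the two roots of the reflection `t`. -/
def IsRootOf (t : W) (β : B → ℝ) : Prop :=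
  ∃ w a, t = w * cs.simple a * w⁻¹ ∧ β = geomRep cs w (simpleRoot a)

theorem isRootOf_simple (a : B) : IsRootOf cs (cs.simple a) (simpleRoot a) :=
  ⟨1, a, by simp, by simp⟩

theorem exists_isRootOf {t : W} (ht : IsReflectionOf (simpleSet cs) t) :
    ∃ β, IsRootOf cs t β := by
  obtain ⟨w, _, ⟨a, rfl⟩, rfl⟩ := ht
  exact ⟨_, w, a, rfl, rfl⟩

variable {cs}

theorem IsRootOf.conj {t : W} {β : B → ℝ} (h : IsRootOf cs t β) (g : W) :
    IsRootOf cs (g * t * g⁻¹) (geomRep cs g β) := by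
  obtain ⟨w, a, rfl, rfl⟩ := h
  exact ⟨g * w, a, by group, by simp⟩

theorem IsRootOf.neg {t : W} {β : B → ℝ} (h : IsRootOf cs t β) : IsRootOf cs t (-β) := by
  obtain ⟨w, a, rfl, rfl⟩ := h
  refine ⟨w * cs.simple a, a, by simp [mul_assoc], ?_⟩
  rw [map_mul, Module.End.mul_apply, geomRep_simple, geomRefl_apply, coxForm_simpleRoot,
    coxGram_self, mul_one, two_smul, sub_add_cancel_left, map_neg]

theorem IsRootOf.coxForm_self {t : W} {β : B → ℝ} (h : IsRootOf cs t β) : coxForm M β β = 1 := by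
  obtain ⟨w, a, rfl, rfl⟩ := h
  rw [coxForm_geomRep, coxForm_simpleRoot, coxGram_self]

theorem IsRootOf.ne_zero {t : W} {β : B → ℝ} (h : IsRootOf cs t β) : β ≠ 0 := by
  rintro rfl
  simpa using h.coxForm_self

theorem IsRootOf.geomRep_apply {t : W} {β : B → ℝ} (h : IsRootOf cs t β) (v : B → ℝ) :
    geomRep cs t v = v - (2 * coxForm M v β) • β := by
  obtain ⟨w, a, rfl, rfl⟩ := h
  rw [map_mul, map_mul, Module.End.mul_apply, Module.End.mul_apply, geomRep_simple, geomRefl_apply,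
    map_sub, geomRep_apply_inv, map_smul]
  congr 3
  rw [← coxForm_geomRep cs w, geomRep_apply_inv]

theorem IsRootOf.eq_iff [Finite W] {t t' : W} {β β' : B → ℝ} (h : IsRootOf cs t β)
    (h' : IsRootOf cs t' β') : t = t' ↔ β = β' ∨ β = -β' := by
  constructor
  · rintro rfl
    have e := h'.geomRep_apply β
    rw [h.geomRep_apply β, h.coxForm_self] at e
    set x := coxForm M β β' with hx
    have e' : β = x • β' := by
      have h2 : (2 : ℝ) • β = (2 : ℝ) • (x • β') := by
        rw [smul_smul]
        simpa using e
      exact smul_right_injective _ two_ne_zero h2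
    have hx2 : x * x = 1 := by
      have := h.coxForm_self
      rw [e'] at this
      simpa [h'.coxForm_self] using this
    rcases mul_self_eq_one_iff.mp hx2 with h1 | h1
    · left; rw [e', h1, one_smul]
    · right; rw [e', h1, neg_smul, one_smul]
  · intro hβ
    apply geomRep_faithful cs
    refine LinearMap.ext fun v => ?_
    rw [h.geomRep_apply, h'.geomRep_apply]
    rcases hβ with rfl | rfl <;> simp

theorem IsRootOf.nonneg_or_nonpos [Finite W] {t : W} {β : B → ℝ} (h : IsRootOf cs t β) :
    0 ≤ β ∨ β ≤ 0 := by
  obtain ⟨w, a, rfl, rfl⟩ := h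
  exact geomRep_simpleRoot_nonneg_or_nonpos cs w a

variable (cs) in
theorem simple_injective [Finite W] : Function.Injective cs.simple := by
  intro a b hab
  by_contra hne
  rcases (IsRootOf.eq_iff (isRootOf_simple cs a) (isRootOf_simple cs b)).mp hab with h | h
  · simpa [simpleRoot, hne] using congrFun h a
  · simpa [simpleRoot, hne] using congrFun h a

theorem IsRootOf.ne_one [Finite W] {t : W} {β : B → ℝ} (h : IsRootOf cs t β) : t ≠ 1 := by
  rintro rfl
  have := h.geomRep_apply β
  rw [h.coxForm_self, map_one, Module.End.one_apply, mul_one, eq_comm, sub_eq_self] at this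
  exact h.ne_zero ((smul_eq_zero.mp this).resolve_left two_ne_zero)

/-- A root whose support contains `i` and otherwise only simple roots orthogonal to the one
indexed by `i` is `±` the simple root indexed by `i`. -/
theorem IsRootOf.eq_simple [Finite W] {t : W} {β : B → ℝ} (h : IsRootOf cs t β) {i : B}
    (hi : β i ≠ 0) (horth : ∀ j, j ≠ i → β j ≠ 0 → coxGram M j i = 0) : t = cs.simple i := by
  have hform : coxForm M β (simpleRoot i) = β i := by
    rw [coxForm_simpleRoot_right, Finset.sum_eq_single i]
    · rw [coxGram_self, mul_one]
    · intro j _ hj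
      by_cases h0 : β j = 0
      · rw [h0, zero_mul]
      · rw [horth j hj h0, mul_zero]
    · simp
  have h1 := (h.conj (cs.simple i)).nonneg_or_nonpos
  have h2 := h.nonneg_or_nonpos
  rw [geomRep_simple, geomRefl_apply, hform] at h1
  have hz : ∀ j, j ≠ i → β j = 0 := by
    intro j hj
    have hc : ∀ k, (β - (2 * β i) • simpleRoot i) k = if k = i then -β i else β k := by
      intro k
      by_cases hk : k = i
      · subst hk; simp [simpleRoot]; ring
      · simp [simpleRoot, hk]
    rcases h1 with h1 | h1 <;> rcases h2 with h2 | h2 <;>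
    · have a1 := h1 j
      have a2 := h2 j
      have a3 := h1 i
      have a4 := h2 i
      simp only [hc, hj, if_true, if_false, Pi.zero_apply] at a1 a2 a3 a4
      first
      | exact absurd (by linarith) hi
      | linarith
  have hβ : β = β i • simpleRoot i := by
    ext k
    by_cases hk : k = i
    · subst hk; simp [simpleRoot]
    · simp [simpleRoot, hk, hz k hk]
  have hsq : β i * β i = 1 := by
    have := congrArg (coxForm M β) hβ
    rwa [h.coxForm_self, map_smul, hform, smul_eq_mul, eq_comm] at this
  refine (h.eq_iff (isRootOf_simple cs i)).mpr ?_
  rcases mul_self_eq_one_iff.mp hsq with h1 | h1 <;> rw [h1] at hβ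
  · left; simpa using hβ
  · right; simpa using hβ

variable (cs)

/-- A reflection whose root lies in the span of the simple roots other than that of `s` is a
reflection of the standard parabolic subgroup omitting `s`. -/
theorem exists_parabolic_conj [Finite W] {t : W} {β : B → ℝ} (h : IsRootOf cs t β) {s : B}
    (hs : β s = 0) :
    ∃ u ∈ parabolic cs s, ∃ b, b ≠ s ∧ t = u * cs.simple b * u⁻¹ := by
  have hmem : ∀ b, b ≠ s → cs.simple b ∈ parabolic cs s := fun b hb =>
    Subgroup.subset_closure ⟨⟨b, rfl⟩, fun h => hb (simple_injective cs h)⟩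
  by_contra hcon
  let Bad : Set (B → ℝ) := {γ | 0 ≤ γ ∧ γ s = 0 ∧ ∃ t', IsRootOf cs t' γ ∧
    ¬ ∃ u ∈ parabolic cs s, ∃ b, b ≠ s ∧ t' = u * cs.simple b * u⁻¹}
  have hfin : Bad.Finite := by
    refine (Set.finite_range fun p : W × B => geomRep cs p.1 (simpleRoot p.2)).subset ?_
    rintro γ ⟨-, -, t', ⟨w, a, -, rfl⟩, -⟩
    exact ⟨(w, a), rfl⟩
  have hne : Bad.Nonempty := by
    rcases h.nonneg_or_nonpos with h0 | h0
    · exact ⟨β, h0, hs, t, h, hcon⟩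
    · exact ⟨-β, neg_nonneg.mpr h0, by simp [hs], t, h.neg, hcon⟩
  obtain ⟨γ, ⟨hγ, hγs, t', ht', hbad⟩, hmin⟩ := Set.exists_min_image Bad (fun γ => ∑ b, γ b) hfin hne
  have hpos : 0 < ∑ b, γ b * coxForm M γ (simpleRoot b) := by
    rw [← coxForm_eq_sum, ht'.coxForm_self]; exact one_pos
  obtain ⟨i, -, hi⟩ := Finset.exists_lt_of_sum_lt (f := fun _ => (0 : ℝ)) (s := Finset.univ)
    (by simpa using hpos)
  have hγi : 0 < γ i := lt_of_le_of_ne (hγ i) (by rintro h0; rw [← h0] at hi; simp at hi)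
  have hBi : 0 < coxForm M γ (simpleRoot i) := by
    by_contra hc
    exact absurd (mul_nonpos_of_nonneg_of_nonpos hγi.le (not_lt.mp hc)) (not_le.mpr hi)
  have his : i ≠ s := by rintro rfl; exact hγi.ne' hγs
  have hconj := ht'.conj (cs.simple i)
  rw [geomRep_simple, geomRefl_apply] at hconj
  set γ' := γ - (2 * coxForm M γ (simpleRoot i)) • simpleRoot i with hγ'
  have hcoord : ∀ k, k ≠ i → γ' k = γ k := by
    intro k hk; simp [hγ', simpleRoot, hk]
  have hi' : γ' i = γ i - 2 * coxForm M γ (simpleRoot i) := by simp [hγ', simpleRoot]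
  rcases hconj.nonneg_or_nonpos with h0 | h0
  · have hlt : ∑ b, γ' b < ∑ b, γ b := by
      refine Finset.sum_lt_sum (fun k _ => ?_) ⟨i, Finset.mem_univ _, by rw [hi']; linarith⟩
      by_cases hk : k = i
      · subst hk; rw [hi']; linarith
      · rw [hcoord k hk]
    refine absurd (hmin γ' ⟨h0, by rw [hcoord s his.symm, hγs], _, hconj, ?_⟩) (not_le.mpr hlt)
    rintro ⟨u, hu, b, hb, e⟩
    apply hbad
    refine ⟨cs.simple i * u, mul_mem (hmem i his) hu, b, hb, ?_⟩
    rw [mul_inv_rev, cs.inv_simple, show cs.simple i * u * cs.simple b * (u⁻¹ * cs.simple i)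
      = cs.simple i * (u * cs.simple b * u⁻¹) * cs.simple i by group, ← e]
    simp [mul_assoc]
  · apply hbad
    refine ⟨1, one_mem _, i, his, ?_⟩
    rw [one_mul, inv_one, mul_one]
    refine ht'.eq_simple hγi.ne' fun j hj hj0 => ?_
    have := h0 j
    rw [hcoord j hj] at this
    exact absurd (le_antisymm this (hγ j)) hj0

theorem geomRep_wordProd_apply_of_notMem (l : List B) (v : B → ℝ) {a : B} (ha : a ∉ l) :
    geomRep cs (cs.wordProd l) v a = v a := by
  induction l with
  | nil => simp
  | cons b l ih =>
    simp only [List.mem_cons, not_or] at ha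
    rw [cs.wordProd_cons, map_mul, Module.End.mul_apply, geomRep_simple, geomRefl_apply]
    simp [simpleRoot, ha.1, ih ha.2]

theorem coxForm_eq_zero_of_wordProd_fixed (l : List B) (hl : l.Nodup) (v : B → ℝ)
    (hv : geomRep cs (cs.wordProd l) v = v) : ∀ a ∈ l, coxForm M v (simpleRoot a) = 0 := by
  induction l with
  | nil => simp
  | cons b l ih =>
    rw [List.nodup_cons] at hl
    rw [cs.wordProd_cons, map_mul, Module.End.mul_apply, geomRep_simple] at hv
    have h1 : geomRep cs (cs.wordProd l) v = geomRefl M b v := by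
      rw [← geomRefl_geomRefl M b (geomRep cs (cs.wordProd l) v), hv]
    have h2 := geomRep_wordProd_apply_of_notMem cs l v hl.1
    have h3 : coxForm M v (simpleRoot b) = 0 := by
      rw [h1, geomRefl_apply] at h2
      simpa [simpleRoot] using h2
    rw [h1, geomRefl_apply, h3] at ih
    simp only [mul_zero, zero_smul, sub_zero, forall_const] at ih
    simpa [h3] using ih hl.2

theorem exists_common_fixed_vector (L : List W)
    (hL : ∀ t ∈ L, IsReflectionOf (simpleSet cs) t) (hlen : L.length < Fintype.card B) :
    ∃ v : B → ℝ, v ≠ 0 ∧ geomRep cs L.prod v = v ∧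
      ∀ t ∈ L, ∃ β, IsRootOf cs t β ∧ coxForm M v β = 0 := by
  choose β hβ using fun t : {t // t ∈ L} => exists_isRootOf cs (hL t t.2)
  let f : (B → ℝ) →ₗ[ℝ] (Fin L.length → ℝ) :=
    LinearMap.pi fun i => (coxForm M).flip (β ⟨L.get i, L.get_mem i⟩)
  have hker : LinearMap.ker f ≠ ⊥ := LinearMap.ker_ne_bot_of_finrank_lt (by simpa using hlen)
  obtain ⟨v, hv, hv0⟩ := Submodule.exists_mem_ne_zero_of_ne_bot hker
  have hv' : ∀ t (ht : t ∈ L), coxForm M v (β ⟨t, ht⟩) = 0 := by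
    intro t ht
    obtain ⟨i, rfl⟩ := List.get_of_mem ht
    exact congrFun (LinearMap.mem_ker.mp hv) i
  refine ⟨v, hv0, ?_, fun t ht => ⟨β ⟨t, ht⟩, hβ ⟨t, ht⟩, hv' t ht⟩⟩
  have hfix : ∀ t ∈ L, geomRep cs t v = v := fun t ht => by
    rw [(hβ ⟨t, ht⟩).geomRep_apply, hv' t ht]; simp
  clear hv' hβ hker hv f hlen hL β
  induction L with
  | nil => simp
  | cons t L ih =>
    rw [List.prod_cons, map_mul, Module.End.mul_apply, ih fun t ht => hfix t (by simp [ht])]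
    exact hfix t (by simp)

/-- A Coxeter element is not a product of fewer reflections than the rank. -/
theorem card_le_length_of_prod_eq [Finite W] (l : List B) (hl : l.Nodup) (hall : ∀ a, a ∈ l)
    (L : List W) (hL : ∀ t ∈ L, IsReflectionOf (simpleSet cs) t)
    (hprod : L.prod = cs.wordProd l) : Fintype.card B ≤ L.length := by
  by_contra hlt
  obtain ⟨v, hv0, hfix, -⟩ := exists_common_fixed_vector cs L hL (not_le.mp hlt)
  rw [hprod] at hfix
  have h := coxForm_eq_zero_of_wordProd_fixed cs l hl v hfix
  have hp := coxForm_pos cs hv0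
  rw [coxForm_eq_sum] at hp
  simp [h _ (hall _)] at hp

/-- In a shortest factorization into reflections of a product of all simple reflections but `s`,
every factor is a reflection of the standard parabolic subgroup omitting `s`. -/
theorem exists_parabolic_conj_of_prod_eq [Finite W] {s : B} (l : List B) (hl : l.Nodup)
    (hall : ∀ a, a ≠ s → a ∈ l)
    (L : List W) (hL : ∀ t ∈ L, IsReflectionOf (simpleSet cs) t)
    (hprod : L.prod = cs.wordProd l) (hlen : L.length < Fintype.card B) :
    ∀ t ∈ L, ∃ u ∈ parabolic cs s, ∃ b, b ≠ s ∧ t = u * cs.simple b * u⁻¹ := by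
  obtain ⟨v, hv0, hfix, horth⟩ := exists_common_fixed_vector cs L hL hlen
  rw [hprod] at hfix
  have h := coxForm_eq_zero_of_wordProd_fixed cs l hl v hfix
  have hsingle : ∀ w : B → ℝ, coxForm M v w = w s * coxForm M v (simpleRoot s) := by
    intro w
    rw [coxForm_eq_sum, Finset.sum_eq_single s]
    · intro b _ hb; rw [h b (hall b hb), mul_zero]
    · simp
  have hp := coxForm_pos cs hv0
  rw [hsingle] at hp
  have hne : coxForm M v (simpleRoot s) ≠ 0 := by rintro h0; rw [h0] at hp; simp at hp
  intro t ht
  obtain ⟨β, hβ, h0⟩ := horth t ht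
  rw [hsingle] at h0
  exact exists_parabolic_conj cs hβ ((mul_eq_zero.mp h0).resolve_right hne)

end Roots

section CoxeterGraph

variable {B : Type*} [Fintype B] [DecidableEq B] {M : CoxeterMatrix B}
  {W : Type*} [Group W] (cs : CoxeterSystem M W)

theorem commute_simple_of_coxGram_eq_zero [Finite W] {a b : B} (h : coxGram M a b = 0) :
    Commute (cs.simple a) (cs.simple b) := by
  apply geomRep_faithful cs
  refine LinearMap.ext fun v => ?_
  have h' : coxGram M b a = 0 := by rw [coxGram_comm, h]
  simp only [map_mul, Module.End.mul_apply, geomRep_simple, geomRefl_apply, map_sub, map_smul,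
    coxForm_simpleRoot, h, h', mul_zero]
  module

theorem coxGram_eq_zero_of_commute [Finite W] {a b : B} (hab : a ≠ b)
    (h : Commute (cs.simple a) (cs.simple b)) : coxGram M a b = 0 := by
  have h1 := (isRootOf_simple cs b).conj (cs.simple a)
  rw [h.eq, mul_inv_cancel_right, geomRep_simple, geomRefl_apply] at h1
  have h2 := (h1.eq_iff (isRootOf_simple cs b)).mp rfl
  rw [coxForm_simpleRoot, coxGram_comm] at h2
  rcases h2 with h2 | h2 <;>
  · have := congrFun h2 a
    simpa [simpleRoot, hab] using this

theorem coxAdj_iff [Finite W] {a b : B} : coxAdj cs a b ↔ a ≠ b ∧ coxGram M a b ≠ 0 := by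
  rw [coxAdj]
  constructor
  · intro h
    refine ⟨?_, fun h0 => ?_⟩
    · rintro rfl
      simp at h
    · have hc := commute_simple_of_coxGram_eq_zero cs h0
      have : (cs.simple a * cs.simple b) ^ 2 = 1 := by
        rw [hc.mul_pow, cs.simple_sq, cs.simple_sq, mul_one]
      have := orderOf_le_of_pow_eq_one two_pos this
      omega
  · rintro ⟨hab, h⟩
    have hpos := orderOf_pos (cs.simple a * cs.simple b)
    have h1 : orderOf (cs.simple a * cs.simple b) ≠ 1 := by
      rw [Ne, orderOf_eq_one_iff, mul_eq_one_iff_eq_inv, cs.inv_simple]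
      exact fun e => hab (simple_injective cs e)
    have h2 : orderOf (cs.simple a * cs.simple b) ≠ 2 := by
      intro e
      apply h
      apply coxGram_eq_zero_of_commute cs hab
      have e2 := pow_orderOf_eq_one (cs.simple a * cs.simple b)
      rw [e, pow_two, mul_eq_one_iff_eq_inv, mul_inv_rev, cs.inv_simple, cs.inv_simple] at e2
      exact e2
    omega

theorem coxGram_le_of_ne_zero (cs : CoxeterSystem M W) [Finite W] {a b : B} (hab : a ≠ b)
    (h : coxGram M a b ≠ 0) :
    coxGram M a b ≤ -(1 / 2) := by
  have h2 := two_le_coxeterMatrix cs hab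
  have h3 : M a b ≠ 2 := by
    intro e
    apply h
    simp [coxGram, e]
  have hm : (3 : ℝ) ≤ M a b := by exact_mod_cast (by omega : 3 ≤ M a b)
  rw [coxGram, neg_le_neg_iff, ← Real.cos_pi_div_three]
  refine Real.cos_le_cos_of_nonneg_of_le_pi (by positivity) ?_ ?_
  · linarith [Real.pi_pos]
  · exact div_le_div_of_nonneg_left Real.pi_pos.le (by norm_num) hm

/-- The Coxeter graph of a finite Coxeter group is a forest: every nonempty set of vertices
contains a vertex with at most one neighbour in the set. -/
theorem exists_leaf (cs : CoxeterSystem M W) [Finite W] (A : Finset B) (hA : A.Nonempty) :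
    ∃ s ∈ A, ∀ a ∈ A, ∀ b ∈ A, a ≠ s → b ≠ s → coxGram M a s ≠ 0 → coxGram M b s ≠ 0 → a = b := by
  by_contra! hcon
  let v : B → ℝ := fun a => if a ∈ A then 1 else 0
  have hv : v ≠ 0 := by
    obtain ⟨a, ha⟩ := hA
    intro h
    have := congrFun h a
    simp [v, ha] at this
  have hp := coxForm_pos cs hv
  rw [coxForm_eq_sum] at hp
  refine absurd hp (not_lt.mpr (Finset.sum_nonpos fun s _ => ?_))
  by_cases hs : s ∈ A
  · obtain ⟨a, ha, b, hb, has, hbs, ga, gb, hab⟩ := hcon s hs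
    have e : coxForm M v (simpleRoot s) = ∑ x ∈ A, coxGram M x s := by
      rw [coxForm_simpleRoot_right]
      simp [v, Finset.sum_ite_mem]
    have hsub : ({s, a, b} : Finset B) ⊆ A := by
      intro x hx
      simp only [Finset.mem_insert, Finset.mem_singleton] at hx
      rcases hx with rfl | rfl | rfl <;> assumption
    have hle : ∑ x ∈ A, coxGram M x s ≤ ∑ x ∈ ({s, a, b} : Finset B), coxGram M x s := by
      rw [← Finset.sum_sdiff hsub]
      refine add_le_of_nonpos_left (Finset.sum_nonpos fun x hx => coxGram_nonpos cs ?_)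
      rintro rfl
      simp at hx
    have h1 := coxGram_le_of_ne_zero cs has ga
    have h2 := coxGram_le_of_ne_zero cs hbs gb
    rw [Finset.sum_insert (by simp [has.symm, hbs.symm]), Finset.sum_insert (by simp [hab]),
      Finset.sum_singleton, coxGram_self] at hle
    simp only [v, hs, if_true, one_mul, e]
    linarith
  · simp [v, hs]

theorem exists_coloring (cs : CoxeterSystem M W) [Finite W] :
    ∃ ε : B → Bool, ∀ a b, a ≠ b → coxGram M a b ≠ 0 → ε a ≠ ε b := by
  suffices h : ∀ n, ∀ A : Finset B, A.card = n →
      ∃ ε : B → Bool, ∀ a ∈ A, ∀ b ∈ A, a ≠ b → coxGram M a b ≠ 0 → ε a ≠ ε b by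
    obtain ⟨ε, hε⟩ := h _ Finset.univ rfl
    exact ⟨ε, fun a b => hε a (Finset.mem_univ _) b (Finset.mem_univ _)⟩
  intro n
  induction n with
  | zero =>
    intro A hA
    rw [Finset.card_eq_zero] at hA
    subst hA
    exact ⟨fun _ => true, by simp⟩
  | succ n ih =>
    intro A hA
    obtain ⟨s, hs, hleaf⟩ := exists_leaf cs A (Finset.card_pos.mp (by omega))
    obtain ⟨ε, hε⟩ := ih (A.erase s) (by rw [Finset.card_erase_of_mem hs]; omega)
    obtain ⟨x, hx⟩ : ∃ x : Bool, ∀ a ∈ A, a ≠ s → coxGram M a s ≠ 0 → ε a ≠ x := by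
      by_cases hn : ∃ a ∈ A, a ≠ s ∧ coxGram M a s ≠ 0
      · obtain ⟨a, ha, has, hga⟩ := hn
        refine ⟨!ε a, fun b hb hbs hgb => ?_⟩
        rw [hleaf b hb a ha hbs has hgb hga]
        simp
      · push Not at hn
        exact ⟨true, fun a ha has hg => absurd (hn a ha has) hg⟩
    refine ⟨Function.update ε s x, fun a ha b hb hab hg => ?_⟩
    by_cases h1 : a = s
    · subst h1
      rw [Function.update_self, Function.update_of_ne hab.symm]
      exact (hx b hb hab.symm (by rwa [coxGram_comm])).symm
    · by_cases h2 : b = s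
      · subst h2
        rw [Function.update_self, Function.update_of_ne hab]
        exact hx a ha hab hg
      · rw [Function.update_of_ne h1, Function.update_of_ne h2]
        exact hε a (Finset.mem_erase.mpr ⟨h1, ha⟩) b (Finset.mem_erase.mpr ⟨h2, hb⟩) hab hg

variable (M) in
/-- Elementary moves on words: rotating the first letter to the end, and exchanging two adjacent
letters with orthogonal simple roots. -/
inductive ConjStep : List B → List B → Prop
  | rotate (a : B) (l : List B) : ConjStep (a :: l) (l ++ [a])
  | swap (u v : List B) (a b : B) (h : coxGram M a b = 0) :
      ConjStep (u ++ a :: b :: v) (u ++ b :: a :: v)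

theorem ConjStep.perm {l l' : List B} (h : ConjStep M l l') : l.Perm l' := by
  cases h with
  | rotate a l => exact (List.perm_append_singleton a l).symm
  | swap u v a b h => exact List.Perm.append_left _ (List.Perm.swap _ _ _)

theorem ConjStep.isConj [Finite W] {l l' : List B} (h : ConjStep M l l') :
    IsConj (cs.wordProd l) (cs.wordProd l') := by
  cases h with
  | rotate a l =>
    rw [isConj_iff]
    exact ⟨cs.simple a, by simp [cs.wordProd_cons, cs.wordProd_append]⟩
  | swap u v a b h =>
    rw [cs.wordProd_append, cs.wordProd_append, cs.wordProd_cons, cs.wordProd_cons,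
      cs.wordProd_cons, cs.wordProd_cons, ← mul_assoc (cs.simple a),
      (commute_simple_of_coxGram_eq_zero cs h).eq, mul_assoc]

open Relation

theorem eqvGen_perm {l l' : List B} (h : EqvGen (ConjStep M) l l') : l.Perm l' := by
  induction h with
  | rel _ _ h => exact h.perm
  | refl => exact List.Perm.refl _
  | symm _ _ _ ih => exact ih.symm
  | trans _ _ _ _ _ ih1 ih2 => exact ih1.trans ih2

theorem eqvGen_append_comm (u v : List B) : EqvGen (ConjStep M) (u ++ v) (v ++ u) := by
  induction u generalizing v with
  | nil => simpa using EqvGen.refl _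
  | cons a u ih =>
    have h1 : EqvGen (ConjStep M) (a :: (u ++ v)) (u ++ v ++ [a]) := .rel _ _ (.rotate _ _)
    have h2 := ih (v ++ [a])
    rw [List.append_assoc] at h1
    simpa using h1.trans _ _ _ h2

theorem eqvGen_move_left (u v t : List B) (s : B) (h : ∀ a ∈ v, coxGram M a s = 0) :
    EqvGen (ConjStep M) (u ++ v ++ s :: t) (u ++ s :: v ++ t) := by
  induction v generalizing u with
  | nil => simpa using EqvGen.refl _
  | cons a v ih =>
    have h1 := ih (u ++ [a]) fun b hb => h b (by simp [hb])
    have h2 : EqvGen (ConjStep M) (u ++ a :: s :: (v ++ t)) (u ++ s :: a :: (v ++ t)) :=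
      .rel _ _ (.swap _ _ _ _ (h a (by simp)))
    refine EqvGen.trans _ (u ++ a :: s :: (v ++ t)) _ ?_ (by simpa using h2)
    simpa using h1

theorem eqvGen_append_singleton {l l' : List B} (h : EqvGen (ConjStep M) l l') (hl : l.Nodup)
    {s : B} (hs : ∀ a ∈ l, ∀ b ∈ l, coxGram M a s ≠ 0 → coxGram M b s ≠ 0 → a = b) :
    EqvGen (ConjStep M) (l ++ [s]) (l' ++ [s]) := by
  induction h with
  | refl => exact EqvGen.refl _
  | symm x y h ih =>
    have hp := eqvGen_perm h
    refine (ih (hp.nodup_iff.mpr hl) ?_).symm _ _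
    simpa only [hp.mem_iff] using hs
  | trans x y z h1 h2 ih1 ih2 =>
    have hp := eqvGen_perm h1
    refine (ih1 hl hs).trans _ _ _ (ih2 (hp.nodup_iff.mp hl) ?_)
    simpa only [hp.mem_iff] using hs
  | rel x y h =>
    cases h with
    | swap u v a b h => simpa using EqvGen.rel _ _ (ConjStep.swap u (v ++ [s]) a b h)
    | rotate a d =>
      have h1 : EqvGen (ConjStep M) (a :: (d ++ [s])) (d ++ [s] ++ [a]) := .rel _ _ (.rotate _ _)
      by_cases ha : coxGram M a s = 0
      · have h2 : EqvGen (ConjStep M) (d ++ s :: a :: []) (d ++ a :: s :: []) :=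
          .rel _ _ (.swap _ _ _ _ (by rwa [coxGram_comm]))
        simpa using h1.trans _ _ _ (by simpa using h2)
      · have hd : ∀ b ∈ d, coxGram M b s = 0 := by
          intro b hb
          by_contra hb0
          have := hs a (by simp) b (by simp [hb]) ha hb0
          subst this
          exact (List.nodup_cons.mp hl).1 hb
        have h2 := eqvGen_move_left [a] d [] s hd
        have h3 := eqvGen_append_comm (M := M) [a] (s :: d)
        have h4 := eqvGen_append_comm (M := M) [s] (d ++ [a])
        simp only [List.cons_append, List.nil_append, List.append_nil] at h2 h3 h4 ⊢
        exact (h2.trans _ _ _ h3).trans _ _ _ h4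

theorem eqvGen_of_perm (cs : CoxeterSystem M W) [Finite W] {l l' : List B} (hl : l.Nodup)
    (hp : l.Perm l') :
    EqvGen (ConjStep M) l l' := by
  induction hn : l.length generalizing l l' with
  | zero =>
    rw [List.length_eq_zero_iff] at hn
    subst hn
    rw [List.nil_perm.mp hp]
    exact EqvGen.refl _
  | succ n ih =>
    obtain ⟨s, hs, hleaf⟩ := exists_leaf cs l.toFinset
      (by rw [List.toFinset_nonempty_iff]; rintro rfl; simp at hn)
    rw [List.mem_toFinset] at hs
    obtain ⟨u, v, rfl⟩ := List.append_of_mem hs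
    obtain ⟨u', v', rfl⟩ := List.append_of_mem (hp.mem_iff.mp hs)
    have e : ∀ u v : List B, EqvGen (ConjStep M) (u ++ s :: v) (v ++ u ++ [s]) := by
      intro u v
      have := eqvGen_append_comm (M := M) (u ++ [s]) v
      simpa using this
    have hnd : (v ++ u ++ [s]).Nodup := (eqvGen_perm (e u v)).nodup_iff.mp hl
    have hperm : (v ++ u).Perm (v' ++ u') := by
      have := ((eqvGen_perm (e u v)).symm.trans hp).trans (eqvGen_perm (e u' v'))
      exact (List.perm_append_right_iff _).mp this
    have hnd' := List.nodup_append.mp hnd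
    refine ((e u v).trans _ _ _ (eqvGen_append_singleton (ih hnd'.1 hperm ?_) hnd'.1 ?_)).trans _ _ _
      ((e u' v').symm _ _)
    · simp at hn ⊢; omega
    · intro a ha b hb ga gb
      have has : ∀ a ∈ v ++ u, a ≠ s := fun a ha => hnd'.2.2 a ha s (by simp)
      refine hleaf a ?_ b ?_ (has a ha) (has b hb) ga gb
      · simp at ha ⊢; tauto
      · simp at hb ⊢; tauto

/-- Two products of the same simple reflections, each occurring once, are conjugate. -/
theorem isConj_wordProd_of_perm [Finite W] {l l' : List B} (hl : l.Nodup) (hp : l.Perm l') :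
    IsConj (cs.wordProd l) (cs.wordProd l') := by
  have h := eqvGen_of_perm cs hl hp
  clear hl hp
  induction h with
  | rel _ _ h => exact h.isConj cs
  | refl => exact IsConj.refl _
  | symm _ _ _ ih => exact ih.symm
  | trans _ _ _ _ _ ih1 ih2 => exact ih1.trans ih2

theorem exists_wordProd_eq_of_isCoxeterElementOf (H : Subgroup W) (A : Set B) {c : H}
    (hA : ∀ a ∈ A, cs.simple a ∈ H)
    (hc : IsCoxeterElementOf {x : H | (x : W) ∈ cs.simple '' A} c)
    (hinj : Function.Injective cs.simple) :
    ∃ l : List B, l.Nodup ∧ (∀ a, a ∈ l ↔ a ∈ A) ∧ cs.wordProd l = c := by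
  obtain ⟨L, hL, hmem, rfl⟩ := hc
  have hex : ∀ x ∈ L.map Subtype.val, ∃ a, cs.simple a = x := by
    intro x hx
    obtain ⟨y, hy, rfl⟩ := List.mem_map.mp hx
    obtain ⟨a, -, ha⟩ := (hmem y).mp hy
    exact ⟨a, ha⟩
  obtain ⟨l, hl⟩ : ∃ l : List B, l.map cs.simple = L.map Subtype.val := by
    have : L.map Subtype.val ∈ Set.range (List.map cs.simple) := by
      rw [Set.range_list_map]
      exact hex
    exact this
  refine ⟨l, ?_, fun a => ?_, ?_⟩
  · refine List.Nodup.of_map cs.simple ?_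
    rw [hl]
    exact hL.map Subtype.val_injective
  · rw [← List.mem_map_of_injective hinj, hl]
    constructor
    · intro h
      obtain ⟨y, hy, e⟩ := List.mem_map.mp h
      obtain ⟨b, hb, hb'⟩ := (hmem y).mp hy
      rwa [← hinj (hb'.trans e)]
    · intro h
      exact List.mem_map.mpr ⟨⟨cs.simple a, hA a h⟩, (hmem _).mpr ⟨a, h, rfl⟩, rfl⟩
  · change (l.map cs.simple).prod = _
    rw [hl]
    exact (map_list_prod H.subtype L).symm

end CoxeterGraph

section Perron

variable {B : Type*} [Fintype B] [DecidableEq B] {M : CoxeterMatrix B}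
  {W : Type*} [Group W] (cs : CoxeterSystem M W)

theorem coxAdj_symm [Finite W] {a b : B} (h : coxAdj cs a b) : coxAdj cs b a := by
  rw [coxAdj_iff] at h ⊢
  rwa [coxGram_comm, ne_comm]

theorem coxAdj_of_coxGram_ne_zero [Finite W] {a b : B} (hab : a ≠ b) (h : coxGram M a b ≠ 0) :
    coxAdj cs a b := (coxAdj_iff cs).mpr ⟨hab, h⟩

theorem mem_coxComponent_self (s : B) : s ∈ coxComponent cs s := Relation.ReflTransGen.refl

theorem mem_coxComponent_of_coxGram_ne_zero [Finite W] {s a b : B} (ha : a ∈ coxComponent cs s)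
    (h : coxGram M a b ≠ 0) : b ∈ coxComponent cs s := by
  rcases eq_or_ne a b with rfl | hab
  · exact ha
  · exact Relation.ReflTransGen.tail ha (coxAdj_of_coxGram_ne_zero cs hab h)

theorem coxComponent_induction [Finite W] {s b : B} (P : B → Prop)
    (hP : ∀ a c, coxGram M a c ≠ 0 → P a → P c) (hb : b ∈ coxComponent cs s) (h : P b) :
    ∀ a ∈ coxComponent cs s, P a := by
  have hs : P s := by
    induction hb with
    | refl => exact h
    | tail _ hadj ih => exact ih (hP _ _ ((coxAdj_iff cs).mp (coxAdj_symm cs hadj)).2 h)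
  intro a ha
  induction ha with
  | refl => exact hs
  | tail _ hadj ih => exact hP _ _ ((coxAdj_iff cs).mp hadj).2 ih

/-- A minimizer of the canonical form on the unit sphere of the span of a set of
simple roots. -/
theorem exists_coxForm_minimizer (M : CoxeterMatrix B) (K : Set B) {s : B} (hs : s ∈ K) :
    ∃ x : B → ℝ, ∃ μ : ℝ, x ≠ 0 ∧ (∀ a ∉ K, x a = 0) ∧ coxForm M x x = μ * (x ⬝ᵥ x) ∧
      ∀ v : B → ℝ, (∀ a ∉ K, v a = 0) → μ * (v ⬝ᵥ v) ≤ coxForm M v v := by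
  let C : Set (B → ℝ) := {v | v ⬝ᵥ v = 1 ∧ ∀ a ∉ K, v a = 0}
  have hclosed : IsClosed C := by
    have h : IsClosed {v : B → ℝ | ∀ a ∉ K, v a = 0} := by
      simp only [Set.ofPred_forall]
      exact isClosed_iInter fun a => isClosed_iInter fun _ =>
        isClosed_eq (continuous_apply a) continuous_const
    exact (isClosed_eq (by unfold dotProduct; fun_prop) continuous_const).inter h
  have hcomp : IsCompact C := by
    refine (isCompact_Icc (a := (-1 : B → ℝ)) (b := 1)).of_isClosed_subset hclosed ?_
    rintro v ⟨hv, -⟩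
    have h1 : ∀ a, |v a| ≤ 1 := by
      intro a
      have : v a * v a ≤ v ⬝ᵥ v :=
        Finset.single_le_sum (f := fun a => v a * v a) (fun b _ => mul_self_nonneg (v b))
          (Finset.mem_univ a)
      rw [hv] at this
      exact abs_le_one_iff_mul_self_le_one.mpr this
    exact ⟨fun a => (abs_le.mp (h1 a)).1, fun a => (abs_le.mp (h1 a)).2⟩
  have hne : C.Nonempty := by
    refine ⟨simpleRoot s, by simp [simpleRoot], fun a ha => ?_⟩
    have : a ≠ s := by rintro rfl; exact ha hs
    simp [simpleRoot, this]
  have hcont : Continuous fun v : B → ℝ => coxForm M v v := by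
    simp only [coxForm_apply]
    fun_prop
  obtain ⟨x, ⟨hx1, hxK⟩, hmin⟩ := hcomp.exists_isMinOn hne hcont.continuousOn
  refine ⟨x, coxForm M x x, ?_, hxK, by rw [hx1, mul_one], fun v hv => ?_⟩
  · rintro rfl
    simp at hx1
  · have h0 : 0 ≤ v ⬝ᵥ v := Finset.sum_nonneg fun a _ => mul_self_nonneg (v a)
    rcases h0.eq_or_lt with h | h
    · have := dotProduct_self_eq_zero.mp h.symm
      simp [this]
    · set r := √(v ⬝ᵥ v) with hr
      have hr0 : 0 < r := Real.sqrt_pos.mpr h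
      have hrr : r * r = v ⬝ᵥ v := Real.mul_self_sqrt h0
      have hmem : r⁻¹ • v ∈ C := by
        refine ⟨?_, fun a ha => by simp [hv a ha]⟩
        rw [smul_dotProduct, dotProduct_smul, ← hrr, smul_eq_mul, smul_eq_mul]
        field_simp
      have := hmin hmem
      simp only [Set.mem_ofPred_eq, map_smul, LinearMap.smul_apply, smul_eq_mul] at this
      rw [← hrr]
      calc coxForm M x x * (r * r) ≤ r⁻¹ * (r⁻¹ * coxForm M v v) * (r * r) := by gcongr
        _ = _ := by field_simp

theorem eq_zero_of_forall_quadratic_nonneg {p q : ℝ} (h : ∀ t : ℝ, 0 ≤ 2 * t * p + t ^ 2 * q) :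
    p = 0 := by
  have hd := discrim_le_zero (a := q) (b := 2 * p) (c := 0) fun t => by
    have := h t
    nlinarith
  rw [discrim] at hd
  nlinarith [sq_nonneg p]

/-- The Gram matrix of an irreducible component has an eigenvector with positive entries. -/
theorem exists_positive_eigenvector [Finite W] (s : B) :
    ∃ x : B → ℝ, ∃ μ : ℝ, (∀ a ∈ coxComponent cs s, 0 < x a) ∧
      (∀ a ∉ coxComponent cs s, x a = 0) ∧ ∀ b, coxForm M x (simpleRoot b) = μ * x b := by
  obtain ⟨y, μ, hy0, hyK, hyμ, hmin⟩ :=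
    exists_coxForm_minimizer M (coxComponent cs s) (mem_coxComponent_self cs s)
  let x : B → ℝ := fun a => |y a|
  have hxx : x ⬝ᵥ x = y ⬝ᵥ y := Finset.sum_congr rfl fun a _ => abs_mul_abs_self (y a)
  have hxK : ∀ a ∉ coxComponent cs s, x a = 0 := fun a ha => by simp [x, hyK a ha]
  have hxμ : coxForm M x x = μ * (x ⬝ᵥ x) := by
    refine le_antisymm ?_ (hmin x hxK)
    rw [hxx, ← hyμ, coxForm_apply, coxForm_apply]
    refine Finset.sum_le_sum fun a _ => Finset.sum_le_sum fun b _ => ?_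
    rcases eq_or_ne a b with rfl | hab
    · rw [coxGram_self, mul_one, mul_one]
      exact (abs_mul_abs_self (y a)).le
    · have h1 := coxGram_nonpos cs hab
      have h2 : y a * y b ≤ |y a| * |y b| := by rw [← abs_mul]; exact le_abs_self _
      change |y a| * _ * |y b| ≤ _
      nlinarith
  have hx0 : ∀ a, 0 ≤ x a := fun a => abs_nonneg _
  have heig : ∀ b, coxForm M x (simpleRoot b) = μ * x b := by
    intro b
    by_cases hb : b ∈ coxComponent cs s
    · rw [← sub_eq_zero]
      refine eq_zero_of_forall_quadratic_nonneg (q := 1 - μ) fun t => ?_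
      have h1 := hmin (x + t • simpleRoot b) fun a ha => by
        have hab : a ≠ b := by rintro rfl; exact ha hb
        simp [hxK a ha, simpleRoot, hab]
      have h2 : (x + t • simpleRoot b) ⬝ᵥ (x + t • simpleRoot b) =
          x ⬝ᵥ x + 2 * t * x b + t ^ 2 := by
        simp [simpleRoot, add_dotProduct, dotProduct_add]
        ring
      rw [h2] at h1
      simp only [map_add, map_smul, LinearMap.add_apply, LinearMap.smul_apply, smul_eq_mul,
        coxForm_simpleRoot, coxGram_self, coxForm_comm M (simpleRoot b) x] at h1
      rw [hxμ] at h1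
      linarith
    · rw [hxK b hb, mul_zero, coxForm_simpleRoot_right]
      refine Finset.sum_eq_zero fun a _ => ?_
      by_cases ha : a ∈ coxComponent cs s
      · by_cases hg : coxGram M a b = 0
        · rw [hg, mul_zero]
        · exact absurd (mem_coxComponent_of_coxGram_ne_zero cs ha hg) hb
      · rw [hxK a ha, zero_mul]
  refine ⟨x, μ, fun b hb => lt_of_le_of_ne (hx0 b) fun hb0 => hy0 ?_, hxK, heig⟩
  have hall := coxComponent_induction cs (fun a => x a = 0) (fun a c hac ha => ?_) hb hb0.symm
  · ext a
    by_cases ha : a ∈ coxComponent cs s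
    · exact abs_eq_zero.mp (hall a ha)
    · exact hyK a ha
  · have h1 := heig a
    rw [ha, mul_zero, coxForm_simpleRoot_right] at h1
    have hnp : ∀ i ∈ Finset.univ, x i * coxGram M i a ≤ 0 := by
      intro i _
      rcases eq_or_ne i a with rfl | hia
      · rw [ha, zero_mul]
      · exact mul_nonpos_of_nonneg_of_nonpos (hx0 i) (coxGram_nonpos cs hia)
    have h2 := (Finset.sum_eq_zero_iff_of_nonpos hnp).mp h1 c (Finset.mem_univ c)
    exact (mul_eq_zero.mp h2).resolve_right (by rwa [coxGram_comm])

end Perron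

section Recurrence

/-- The solution of `u (m + 2) = r * u (m + 1) - u m` with initial values `0` and `1`. -/
def chebSeq (r : ℝ) : ℕ → ℝ
  | 0 => 0
  | 1 => 1
  | m + 2 => r * chebSeq r (m + 1) - chebSeq r m

/-- Sequences satisfying a two-step recurrence whose consecutive terms never have opposite signs
and never vanish simultaneously. -/
structure IsCoherent (r : ℝ) (g : ℕ → ℝ) : Prop where
  recurrence : ∀ m, g (m + 2) = r * g (m + 1) - g m
  mul_nonneg : ∀ m, 0 ≤ g m * g (m + 1)
  ne_zero : ∀ m, g m = 0 → g (m + 1) ≠ 0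

variable {r : ℝ}

theorem recurrence_eq_chebSeq {g : ℕ → ℝ} (hg : ∀ m, g (m + 2) = r * g (m + 1) - g m) (m k : ℕ) :
    g (m + k + 1) = chebSeq r (k + 1) * g (m + 1) - chebSeq r k * g m := by
  induction k using Nat.twoStepInduction with
  | zero => simp [chebSeq]
  | one => simp [chebSeq, hg]
  | more k h1 h2 =>
    rw [show m + (k + 2) + 1 = m + k + 1 + 2 by ring, hg, h1,
      show m + k + 1 + 1 = m + (k + 1) + 1 by ring, h2]
    simp only [chebSeq]
    ring

theorem chebSeq_invariant (m : ℕ) :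
    chebSeq r (m + 1) ^ 2 - r * chebSeq r (m + 1) * chebSeq r m + chebSeq r m ^ 2 = 1 := by
  induction m with
  | zero => simp [chebSeq]
  | succ m ih =>
    rw [← ih]
    simp only [chebSeq]
    ring

/-- `H` is the first positive index at which `chebSeq r` vanishes, and the sequence changes sign
there. -/
structure IsHalfPeriod (r : ℝ) (H : ℕ) : Prop where
  pos : 0 < H
  eq_zero : chebSeq r H = 0
  eq_one : chebSeq r (H - 1) = 1
  ne_zero : ∀ k, 0 < k → k < H → chebSeq r k ≠ 0

theorem exists_isHalfPeriod (hnn : ∀ m, 0 ≤ chebSeq r m * chebSeq r (m + 1)) {N : ℕ} (hN : 0 < N)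
    (h0 : chebSeq r N = 0) : ∃ H, IsHalfPeriod r H := by
  classical
  have hex : ∃ k, 0 < k ∧ chebSeq r k = 0 := ⟨N, hN, h0⟩
  have hmin : ∀ k, 0 < k → k < Nat.find hex → chebSeq r k ≠ 0 := fun k hk hlt h =>
    Nat.find_min hex hlt ⟨hk, h⟩
  obtain ⟨hpos, hzero⟩ := Nat.find_spec hex
  set H := Nat.find hex
  have hgt : ∀ k, 0 < k → k < H → 0 < chebSeq r k := by
    intro k hk
    induction k, hk using Nat.le_induction with
    | base => intro _; simp [chebSeq]
    | succ k hk ih =>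
      intro hlt
      have h1 := ih (by omega)
      refine lt_of_le_of_ne ?_ (hmin _ (by omega) hlt).symm
      exact le_of_mul_le_mul_left (by simpa using hnn k) h1
  refine ⟨H, hpos, hzero, ?_, hmin⟩
  have hH1 : H ≠ 1 := by
    intro h
    rw [h] at hzero
    simp [chebSeq] at hzero
  have hp := hgt (H - 1) (by omega) (by omega)
  have hinv := chebSeq_invariant (r := r) (H - 1)
  rw [show H - 1 + 1 = H by omega, hzero] at hinv
  nlinarith

namespace IsHalfPeriod

variable {H : ℕ} (hH : IsHalfPeriod r H)

include hH

theorem add_eq_neg {g : ℕ → ℝ} (hg : ∀ m, g (m + 2) = r * g (m + 1) - g m) (m : ℕ) :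
    g (m + H) = -g m := by
  have h := recurrence_eq_chebSeq hg m (H - 1)
  have hp := hH.pos
  rw [show m + (H - 1) + 1 = m + H by omega, show H - 1 + 1 = H by omega, hH.eq_zero,
    hH.eq_one] at h
  rw [h]; ring

theorem add_two_mul {g : ℕ → ℝ} (hg : ∀ m, g (m + 2) = r * g (m + 1) - g m) (m q : ℕ) :
    g (m + 2 * (H * q)) = g m := by
  induction q with
  | zero => simp
  | succ q ih =>
    rw [show m + 2 * (H * (q + 1)) = m + 2 * (H * q) + H + H by ring, hH.add_eq_neg hg,
      hH.add_eq_neg hg, neg_neg, ih]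

theorem dvd_of_periodic {k : ℕ} (h : ∀ m, chebSeq r (m + 2 * k) = chebSeq r m) : H ∣ k := by
  have hrec : ∀ m, chebSeq r (m + 2) = r * chebSeq r (m + 1) - chebSeq r m := fun m => rfl
  have hlt := Nat.mod_lt k hH.pos
  rw [Nat.dvd_iff_mod_eq_zero]
  set e := k % H
  have hper : ∀ m, chebSeq r (m + 2 * e) = chebSeq r m := by
    intro m
    rw [← h m, ← Nat.mod_add_div k H, mul_add, ← add_assoc, hH.add_two_mul hrec]
  by_contra he
  have h0 := hper 0
  have h1 := hper 1
  simp only [chebSeq, zero_add] at h0 h1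
  by_cases h2 : 2 * e < H
  · exact hH.ne_zero _ (by omega) h2 h0
  · obtain ⟨d, hd⟩ := Nat.exists_eq_add_of_le (not_lt.mp h2)
    rw [hd, add_comm H d, hH.add_eq_neg hrec, neg_eq_zero] at h0
    have hd0 : d = 0 := by
      by_contra hd0
      exact hH.ne_zero d (by omega) (by omega) h0
    rw [hd, hd0, add_zero, hH.add_eq_neg hrec] at h1
    simp only [chebSeq] at h1
    norm_num at h1

theorem exists_zero {g : ℕ → ℝ} (hg : IsCoherent r g) : ∃ a < H, g a = 0 := by
  by_contra! hcon
  have hsame : ∀ m < H, 0 < g 0 * g m := by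
    intro m
    induction m with
    | zero => intro h; exact mul_self_pos.mpr (hcon 0 h)
    | succ m ih =>
      intro h
      have h1 := ih (by omega)
      have h2 : 0 < g m * g (m + 1) :=
        lt_of_le_of_ne (hg.mul_nonneg m) (mul_ne_zero (hcon m (by omega)) (hcon _ h)).symm
      have h3 : 0 < g m * g m := mul_self_pos.mpr (hcon m (by omega))
      have h4 : 0 < (g m * g m) * (g 0 * g (m + 1)) := by nlinarith [mul_pos h1 h2]
      exact (mul_pos_iff_of_pos_left h3).mp h4
  have hp := hH.pos
  have h1 := hsame (H - 1) (by omega)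
  have h2 := hg.mul_nonneg (H - 1)
  have h3 := hH.add_eq_neg hg.recurrence 0
  rw [zero_add] at h3
  rw [show H - 1 + 1 = H by omega, h3] at h2
  linarith

/-- A coherent sequence vanishes exactly twice along a full period. -/
theorem card_zeros {g : ℕ → ℝ} (hg : IsCoherent r g) :
    ((Finset.range (2 * H)).filter fun m => g m = 0).card = 2 := by
  obtain ⟨a, haH, ha⟩ := hH.exists_zero hg
  have hp := hH.pos
  have hne : ∀ i, 0 < i → i < H → g (a + i) ≠ 0 := by
    intro i hi hiH
    obtain ⟨i, rfl⟩ : ∃ i', i = i' + 1 := ⟨i - 1, by omega⟩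
    rw [← add_assoc, recurrence_eq_chebSeq hg.recurrence, ha, mul_zero, sub_zero]
    exact mul_ne_zero (hH.ne_zero _ hi hiH) (hg.ne_zero a ha)
  have hshift := hH.add_eq_neg hg.recurrence
  have hz : ∀ m, m < H → g m = 0 → m = a := by
    intro m hm h0
    rcases lt_trichotomy m a with h | h | h
    · exfalso
      apply hne (m + H - a) (by omega) (by omega)
      rw [show a + (m + H - a) = m + H by omega, hshift, h0, neg_zero]
    · exact h
    · exfalso
      apply hne (m - a) (by omega) (by omega)
      rw [show a + (m - a) = m by omega, h0]
  have : (Finset.range (2 * H)).filter (fun m => g m = 0) = {a, a + H} := by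
    ext m
    simp only [Finset.mem_filter, Finset.mem_range, Finset.mem_insert, Finset.mem_singleton]
    constructor
    · rintro ⟨hm, h0⟩
      by_cases h : m < H
      · exact Or.inl (hz m h h0)
      · right
        obtain ⟨d, rfl⟩ := Nat.exists_eq_add_of_le' (not_lt.mp h)
        rw [hshift, neg_eq_zero] at h0
        rw [hz d (by omega) h0]
    · rintro (rfl | rfl)
      · exact ⟨by omega, ha⟩
      · exact ⟨by omega, by rw [hshift, ha, neg_zero]⟩
  rw [this, Finset.card_pair (by omega)]

theorem sum_zeros {g : ℕ → ℝ} (hg : IsCoherent r g) :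
    ∑ k ∈ Finset.range H, ((if g (2 * k) = 0 then 1 else 0) +
      (if g (2 * k + 1) = 0 then 1 else 0)) = 2 := by
  refine Eq.trans ?_ (hH.card_zeros hg)
  rw [Finset.card_filter]
  clear hH hg
  induction H with
  | zero => simp
  | succ n ih =>
    rw [Finset.sum_range_succ, ih, show 2 * (n + 1) = 2 * n + 1 + 1 by ring,
      Finset.sum_range_succ, Finset.sum_range_succ, add_assoc]

end IsHalfPeriod

end Recurrence

section CoxeterPlane

variable {B : Type*} [Fintype B] [DecidableEq B] {M : CoxeterMatrix B}
  {W : Type*} [Group W] {cs : CoxeterSystem M W}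

theorem geomRep_wordProd_simpleRoot (l : List B) {b : B} (hb : ∀ a ∈ l, coxGram M b a = 0) :
    geomRep cs (cs.wordProd l) (simpleRoot b) = simpleRoot b := by
  induction l with
  | nil => simp
  | cons a l ih =>
    rw [cs.wordProd_cons, map_mul, Module.End.mul_apply, ih fun c hc => hb c (by simp [hc]),
      geomRep_simple, geomRefl_apply, coxForm_simpleRoot, hb a (by simp)]
    simp

/-- The action of a product of pairwise orthogonal simple reflections. -/
theorem geomRep_wordProd_apply_of_mem (l : List B) (hl : l.Nodup)
    (horth : ∀ a ∈ l, ∀ b ∈ l, a ≠ b → coxGram M a b = 0) (v : B → ℝ) {a : B} (ha : a ∈ l) :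
    geomRep cs (cs.wordProd l) v a = v a - 2 * coxForm M v (simpleRoot a) := by
  induction l with
  | nil => simp at ha
  | cons b l ih =>
    rw [List.nodup_cons] at hl
    have hbl : ∀ c ∈ l, coxGram M b c = 0 := fun c hc =>
      horth b (by simp) c (by simp [hc]) (by rintro rfl; exact hl.1 hc)
    have h1 : coxForm M (geomRep cs (cs.wordProd l) v) (simpleRoot b) =
        coxForm M v (simpleRoot b) := by
      conv_lhs => rw [← geomRep_wordProd_simpleRoot (cs := cs) l hbl]
      rw [coxForm_geomRep]
    rw [cs.wordProd_cons, map_mul, Module.End.mul_apply, geomRep_simple, geomRefl_apply, h1]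
    rcases eq_or_ne a b with rfl | hab
    · rw [Pi.sub_apply, geomRep_wordProd_apply_of_notMem cs l v hl.1]
      simp [simpleRoot]
    · have hal : a ∈ l := by simpa [hab] using ha
      rw [Pi.sub_apply, ih hl.2 (fun c hc d hd => horth c (by simp [hc]) d (by simp [hd])) hal]
      simp [simpleRoot, hab]

/-- `x` is an eigenvector of the Gram matrix, positive on `K` and zero elsewhere, where `K` is a
union of connected components of the Coxeter graph. -/
structure IsPerronVector (M : CoxeterMatrix B) (K : Set B) (x : B → ℝ) (μ : ℝ) : Prop where
  pos : ∀ a ∈ K, 0 < x a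
  eq_zero : ∀ a ∉ K, x a = 0
  closed : ∀ a ∈ K, ∀ b, coxGram M a b ≠ 0 → b ∈ K
  eigen : ∀ b, coxForm M x (simpleRoot b) = μ * x b

/-- The words `l false` and `l true` list vertices of the respective colours without repetition,
including all those in `K`. -/
structure IsBipartiteCover (ε : B → Bool) (K : Set B) (l : Bool → List B) : Prop where
  nodup : ∀ e, (l e).Nodup
  color : ∀ e, ∀ a ∈ l e, ε a = e
  mem : ∀ a ∈ K, a ∈ l (ε a)

/-- The pairing of `v` with the part of `x` of colour `e`. -/
def colorSum (ε : B → Bool) (x : B → ℝ) (e : Bool) (v : B → ℝ) : ℝ :=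
  ∑ a, (if ε a = e then x a else 0) * v a

theorem colorSum_simpleRoot (ε : B → Bool) (x : B → ℝ) (e : Bool) (a : B) :
    colorSum ε x e (simpleRoot a) = if ε a = e then x a else 0 := by
  simp [colorSum, simpleRoot, Pi.single_apply]

theorem colorSum_neg (ε : B → Bool) (x : B → ℝ) (e : Bool) (v : B → ℝ) :
    colorSum ε x e (-v) = -colorSum ε x e v := by
  simp [colorSum]

theorem IsPerronVector.nonneg {K : Set B} {x : B → ℝ} {μ : ℝ} (hx : IsPerronVector M K x μ)
    (a : B) : 0 ≤ x a := by
  by_cases ha : a ∈ K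
  · exact (hx.pos a ha).le
  · exact (hx.eq_zero a ha).ge

theorem IsPerronVector.colorSum_nonneg {K : Set B} {x : B → ℝ} {μ : ℝ}
    (hx : IsPerronVector M K x μ) (ε : B → Bool) (e : Bool) {v : B → ℝ} (hv : 0 ≤ v) :
    0 ≤ colorSum ε x e v :=
  Finset.sum_nonneg fun a _ => mul_nonneg (by split_ifs; exacts [hx.nonneg a, le_rfl]) (hv a)

theorem IsPerronVector.sum_color {K : Set B} {x : B → ℝ} {μ : ℝ} (hx : IsPerronVector M K x μ)
    {ε : B → Bool} (hε : ∀ a b, a ≠ b → coxGram M a b ≠ 0 → ε a ≠ ε b) (e : Bool) (b : B) :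
    ∑ a, (if ε a = e then x a else 0) * coxGram M b a =
      if ε b = e then x b else (μ - 1) * x b := by
  have hsame : ∑ a, (if ε a = ε b then x a else 0) * coxGram M b a = x b := by
    rw [Finset.sum_eq_single b]
    · simp [coxGram_self]
    · intro a _ hab
      split_ifs with h
      · by_contra h0
        exact hε a b hab (by rw [coxGram_comm]; exact right_ne_zero_of_mul h0) h
      · rw [zero_mul]
    · simp
  by_cases h : ε b = e
  · rw [if_pos h, ← h, hsame]
  · rw [if_neg h]
    have h1 := hx.eigen b
    rw [coxForm_simpleRoot_right] at h1
    have h2 : ∑ a, x a * coxGram M a b = ∑ a, (if ε a = e then x a else 0) * coxGram M b a +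
        ∑ a, (if ε a = ε b then x a else 0) * coxGram M b a := by
      rw [← Finset.sum_add_distrib]
      refine Finset.sum_congr rfl fun a _ => ?_
      rw [coxGram_comm M b a, ← add_mul]
      congr 1
      by_cases ha : ε a = e
      · rw [if_pos ha, if_neg (by rw [ha]; exact fun h' => h h'.symm), add_zero]
      · rw [if_neg ha, if_pos (by revert h ha; cases ε a <;> cases ε b <;> cases e <;> simp),
          zero_add]
    rw [h1, hsame] at h2
    linarith

section

variable {K : Set B} {x : B → ℝ} {μ : ℝ} (hx : IsPerronVector M K x μ)
  {ε : B → Bool} (hε : ∀ a b, a ≠ b → coxGram M a b ≠ 0 → ε a ≠ ε b)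
  {l : Bool → List B} (hl : IsBipartiteCover ε K l)

include hl in
theorem IsBipartiteCover.colorSum_not (e : Bool) (v : B → ℝ) :
    colorSum ε x (!e) (geomRep cs (cs.wordProd (l e)) v) = colorSum ε x (!e) v := by
  refine Finset.sum_congr rfl fun a _ => ?_
  split_ifs with h
  · rw [geomRep_wordProd_apply_of_notMem]
    intro ha
    rw [hl.color e a ha] at h
    simp at h
  · simp

include hx hε hl in
theorem IsBipartiteCover.colorSum_self (e : Bool) (v : B → ℝ) :
    colorSum ε x e (geomRep cs (cs.wordProd (l e)) v) =
      -colorSum ε x e v + (2 - 2 * μ) * colorSum ε x (!e) v := by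
  have h1 : colorSum ε x e (geomRep cs (cs.wordProd (l e)) v) =
      ∑ a, (if ε a = e then x a else 0) * (v a - 2 * coxForm M v (simpleRoot a)) := by
    refine Finset.sum_congr rfl fun a _ => ?_
    split_ifs with h
    · by_cases ha : a ∈ K
      · rw [geomRep_wordProd_apply_of_mem _ (hl.nodup e)]
        · intro a ha b hb hab
          by_contra h0
          exact hε a b hab h0 (by rw [hl.color e a ha, hl.color e b hb])
        · rw [← h]; exact hl.mem a ha
      · rw [hx.eq_zero a ha, zero_mul, zero_mul]
    · simp
  have h2 : ∑ a, (if ε a = e then x a else 0) * coxForm M v (simpleRoot a) =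
      colorSum ε x e v + (μ - 1) * colorSum ε x (!e) v := by
    simp_rw [coxForm_simpleRoot_right, Finset.mul_sum]
    rw [Finset.sum_comm, colorSum, colorSum, Finset.mul_sum, ← Finset.sum_add_distrib]
    refine Finset.sum_congr rfl fun b _ => ?_
    have h3 := hx.sum_color hε e b
    calc ∑ a, (if ε a = e then x a else 0) * (v b * coxGram M b a)
        = v b * ∑ a, (if ε a = e then x a else 0) * coxGram M b a := by
          rw [Finset.mul_sum]
          exact Finset.sum_congr rfl fun a _ => by ring
      _ = _ := by
          rw [h3]
          by_cases hb : ε b = e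
          · simp [hb]; ring
          · have hb' : ε b = !e := by revert hb; cases ε b <;> cases e <;> simp
            simp [hb']; ring
  rw [h1]
  simp_rw [mul_sub, Finset.sum_sub_distrib, mul_left_comm _ (2 : ℝ), ← Finset.mul_sum]
  rw [h2, colorSum, colorSum]
  ring

/-- The two colour sums along the orbit of `v` under powers of `c`, interleaved. -/
noncomputable def orbitSeq (cs : CoxeterSystem M W) (ε : B → Bool) (x : B → ℝ) (c : W) (v : B → ℝ)
    (m : ℕ) : ℝ :=
  colorSum ε x (decide (m % 2 = 0)) (geomRep cs (c ^ (m / 2)) v)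

theorem orbitSeq_even (c : W) (v : B → ℝ) (k : ℕ) :
    orbitSeq cs ε x c v (2 * k) = colorSum ε x true (geomRep cs (c ^ k) v) := by
  simp [orbitSeq]

theorem orbitSeq_odd (c : W) (v : B → ℝ) (k : ℕ) :
    orbitSeq cs ε x c v (2 * k + 1) = colorSum ε x false (geomRep cs (c ^ k) v) := by
  rw [orbitSeq, show (2 * k + 1) / 2 = k by omega, show (2 * k + 1) % 2 = 1 by omega]
  rfl

include hx hε hl in
theorem IsBipartiteCover.orbitSeq_recurrence (v : B → ℝ) (m : ℕ) :
    orbitSeq cs ε x (cs.wordProd (l false) * cs.wordProd (l true)) v (m + 2) =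
      (2 - 2 * μ) * orbitSeq cs ε x (cs.wordProd (l false) * cs.wordProd (l true)) v (m + 1) -
        orbitSeq cs ε x (cs.wordProd (l false) * cs.wordProd (l true)) v m := by
  set c := cs.wordProd (l false) * cs.wordProd (l true) with hc
  have htrue : ∀ k, colorSum ε x true (geomRep cs (c ^ (k + 1)) v) =
      -colorSum ε x true (geomRep cs (c ^ k) v) +
        (2 - 2 * μ) * colorSum ε x false (geomRep cs (c ^ k) v) := by
    intro k
    rw [pow_succ', hc, mul_assoc, map_mul, Module.End.mul_apply]
    have h1 := hl.colorSum_not (cs := cs) (x := x) false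
    rw [Bool.not_false] at h1
    rw [h1, map_mul, Module.End.mul_apply, hl.colorSum_self hx hε]
    rfl
  obtain ⟨k, rfl | rfl⟩ : ∃ k, m = 2 * k ∨ m = 2 * k + 1 := ⟨m / 2, by omega⟩
  · rw [orbitSeq_odd, orbitSeq_even, show 2 * k + 2 = 2 * (k + 1) by ring, orbitSeq_even, htrue]
    ring
  · rw [show 2 * k + 1 + 2 = 2 * (k + 1) + 1 by ring, show 2 * k + 1 + 1 = 2 * (k + 1) by ring,
      orbitSeq_odd, orbitSeq_odd, orbitSeq_even]
    have h2 := htrue k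
    rw [pow_succ', hc, mul_assoc, map_mul, Module.End.mul_apply] at h2 ⊢
    have h1 := hl.colorSum_not (cs := cs) (x := x) false
    rw [Bool.not_false] at h1
    rw [hl.colorSum_self hx hε, Bool.not_false, h1]
    rw [map_mul, Module.End.mul_apply]
    have h3 := hl.colorSum_not (cs := cs) (x := x) true
    rw [Bool.not_true] at h3
    rw [h3]
    ring

include hx in
theorem IsPerronVector.geomRep_apply_eq_zero (w : W) {v : B → ℝ} (hv : ∀ a ∉ K, v a = 0) :
    ∀ a ∉ K, geomRep cs w v a = 0 := by
  induction w using cs.simple_induction_left with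
  | one => simpa using hv
  | mul_simple_left w b ih =>
    intro a ha
    rw [map_mul, Module.End.mul_apply, geomRep_simple, geomRefl_apply, Pi.sub_apply, ih a ha]
    rcases eq_or_ne a b with rfl | hab
    · have : coxForm M (geomRep cs w v) (simpleRoot a) = 0 := by
        rw [coxForm_simpleRoot_right]
        refine Finset.sum_eq_zero fun d _ => ?_
        by_cases hd : d ∈ K
        · by_contra h0
          exact ha (hx.closed d hd a (right_ne_zero_of_mul h0))
        · rw [ih d hd, zero_mul]
      rw [this]; simp
    · simp [simpleRoot, hab]

include hx in
theorem IsPerronVector.colorSum_eq_zero_iff {β : B → ℝ} (hβ : 0 ≤ β ∨ β ≤ 0)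
    (hK : ∀ a ∉ K, β a = 0) (e : Bool) :
    colorSum ε x e β = 0 ↔ ∀ a, ε a = e → β a = 0 := by
  have key : ∀ β : B → ℝ, 0 ≤ β → (∀ a ∉ K, β a = 0) → colorSum ε x e β = 0 →
      ∀ a, ε a = e → β a = 0 := by
    intro β hβ hK h a ha
    rw [colorSum, Finset.sum_eq_zero_iff_of_nonneg fun b _ => mul_nonneg
      (by split_ifs; exacts [hx.nonneg b, le_rfl]) (hβ b)] at h
    have h1 := h a (Finset.mem_univ a)
    rw [if_pos ha] at h1
    by_cases haK : a ∈ K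
    · exact (mul_eq_zero.mp h1).resolve_left (hx.pos a haK).ne'
    · exact hK a haK
  constructor
  · intro h
    rcases hβ with hβ | hβ
    · exact key β hβ hK h
    · have := key (-β) (neg_nonneg.mpr hβ) (by simpa using hK) (by rw [colorSum_neg, h, neg_zero])
      simpa using this
  · intro h
    refine Finset.sum_eq_zero fun a _ => ?_
    split_ifs with ha
    · rw [h a ha, mul_zero]
    · rw [zero_mul]

include hx in
theorem IsPerronVector.colorSum_mul_nonneg {β : B → ℝ} (hβ : 0 ≤ β ∨ β ≤ 0) (e e' : Bool) :
    0 ≤ colorSum ε x e β * colorSum ε x e' β := by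
  rcases hβ with hβ | hβ
  · exact mul_nonneg (hx.colorSum_nonneg ε e hβ) (hx.colorSum_nonneg ε e' hβ)
  · have h1 := hx.colorSum_nonneg ε e (neg_nonneg.mpr hβ)
    have h2 := hx.colorSum_nonneg ε e' (neg_nonneg.mpr hβ)
    rw [colorSum_neg] at h1 h2
    nlinarith

include hx hε hl in
theorem IsBipartiteCover.isCoherent [Finite W] {t : W} {β : B → ℝ} (h : IsRootOf cs t β)
    (hK : ∀ a ∉ K, β a = 0) :
    IsCoherent (2 - 2 * μ)
      (orbitSeq cs ε x (cs.wordProd (l false) * cs.wordProd (l true)) β) := by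
  have hrec := hl.orbitSeq_recurrence (cs := cs) hx hε β
  have hmk : ∀ k, ∃ γ, (∃ t', IsRootOf cs t' γ) ∧ (∀ a ∉ K, γ a = 0) ∧
      ∃ e, orbitSeq cs ε x (cs.wordProd (l false) * cs.wordProd (l true)) β k =
        colorSum ε x e γ ∧
        orbitSeq cs ε x (cs.wordProd (l false) * cs.wordProd (l true)) β (k + 1) =
        colorSum ε x (!e) γ := by
    intro m
    obtain ⟨k, rfl | rfl⟩ : ∃ k, m = 2 * k ∨ m = 2 * k + 1 := ⟨m / 2, by omega⟩
    · exact ⟨_, ⟨_, h.conj _⟩, hx.geomRep_apply_eq_zero _ hK, true, orbitSeq_even _ _ _,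
        orbitSeq_odd _ _ _⟩
    · refine ⟨_, ⟨_, h.conj (cs.wordProd (l true) *
        (cs.wordProd (l false) * cs.wordProd (l true)) ^ k)⟩, hx.geomRep_apply_eq_zero _ hK,
        false, ?_, ?_⟩
      · rw [orbitSeq_odd, map_mul, Module.End.mul_apply]
        exact (hl.colorSum_not true _).symm
      · rw [show 2 * k + 1 + 1 = 2 * (k + 1) by ring, orbitSeq_even, pow_succ', mul_assoc, map_mul,
          Module.End.mul_apply]
        exact hl.colorSum_not false _
  refine ⟨hrec, fun m => ?_, fun m h0 h1 => ?_⟩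
  · obtain ⟨γ, ⟨t', ht'⟩, hγK, e, h0, h1⟩ := hmk m
    rw [h0, h1]
    exact hx.colorSum_mul_nonneg ht'.nonneg_or_nonpos _ _
  · obtain ⟨γ, ⟨t', ht'⟩, hγK, e, h2, h3⟩ := hmk m
    rw [h2, hx.colorSum_eq_zero_iff ht'.nonneg_or_nonpos hγK] at h0
    rw [h3, hx.colorSum_eq_zero_iff ht'.nonneg_or_nonpos hγK] at h1
    apply ht'.ne_zero
    ext a
    by_cases ha : ε a = e
    · exact h0 a ha
    · exact h1 a (by revert ha; cases ε a <;> cases e <;> simp)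

include hx hε in
theorem IsPerronVector.colorSum_eq_zero_iff_exists [Finite W] {t : W} {β : B → ℝ}
    (h : IsRootOf cs t β) (hK : ∀ a ∉ K, β a = 0) (e : Bool) :
    colorSum ε x e β = 0 ↔ ∃ s, ε s = !e ∧ t = cs.simple s := by
  rw [hx.colorSum_eq_zero_iff h.nonneg_or_nonpos hK]
  constructor
  · intro h0
    obtain ⟨s, hs⟩ := Function.ne_iff.mp h.ne_zero
    have hcol : ∀ a, β a ≠ 0 → ε a = !e := by
      intro a ha
      have : ε a ≠ e := fun h' => ha (h0 a h')
      revert this; cases ε a <;> cases e <;> simp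
    refine ⟨s, hcol s hs, h.eq_simple hs fun j hj hj0 => ?_⟩
    by_contra hg
    exact hε j s hj hg (by rw [hcol j hj0, hcol s hs])
  · rintro ⟨s, hs, rfl⟩ a ha
    have has : a ≠ s := by rintro rfl; rw [ha] at hs; cases e <;> simp at hs
    rcases (h.eq_iff (isRootOf_simple cs s)).mp rfl with rfl | rfl <;> simp [simpleRoot, has]

end

end CoxeterPlane

section CoxeterNumber

variable {B : Type*} [Fintype B] [DecidableEq B] {M : CoxeterMatrix B}
  {W : Type*} [Group W] {cs : CoxeterSystem M W}

theorem IsBipartiteCover.mono {ε : B → Bool} {K K' : Set B} {l : Bool → List B}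
    (hl : IsBipartiteCover ε K l) (h : K' ⊆ K) : IsBipartiteCover ε K' l :=
  ⟨hl.nodup, hl.color, fun a ha => hl.mem a (h ha)⟩

theorem exists_isBipartiteCover (ε : B → Bool) (K : Set B) :
    ∃ l, IsBipartiteCover ε K l ∧ ∀ e, ∀ a ∈ l e, a ∈ K := by
  classical
  refine ⟨fun e => Finset.univ.toList.filter fun a => ε a = e ∧ a ∈ K, ⟨fun e => ?_, ?_, ?_⟩, ?_⟩
  · exact (Finset.nodup_toList _).filter _
  · intro e a ha
    simp at ha
    exact ha.1
  · intro a ha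
    simpa using ha
  · intro e a ha
    simp at ha
    exact ha.2

theorem orbitSeq_add_of_pow_eq_one {ε : B → Bool} {x : B → ℝ} {c : W} {v : B → ℝ} {k : ℕ}
    (h : c ^ k = 1) (m : ℕ) : orbitSeq cs ε x c v (m + 2 * k) = orbitSeq cs ε x c v m := by
  rw [orbitSeq, orbitSeq, show (m + 2 * k) % 2 = m % 2 by omega,
    show (m + 2 * k) / 2 = m / 2 + k by omega, pow_add, h, mul_one]

section

variable {K : Set B} {x : B → ℝ} {μ : ℝ} (hx : IsPerronVector M K x μ)
  {ε : B → Bool} (hε : ∀ a b, a ≠ b → coxGram M a b ≠ 0 → ε a ≠ ε b)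
  {l : Bool → List B} (hl : IsBipartiteCover ε K l)

include hx in
theorem IsPerronVector.simpleRoot_eq_zero {a : B} (ha : a ∈ K) :
    ∀ b ∉ K, (simpleRoot a : B → ℝ) b = 0 := by
  intro b hb
  have : b ≠ a := by rintro rfl; exact hb ha
  simp [simpleRoot, this]

include hx hε hl in
theorem IsBipartiteCover.exists_orbitSeq_eq_chebSeq {a : B} (ha : a ∈ K) :
    ∃ y ≠ 0, ∃ i, ∀ m,
      orbitSeq cs ε x (cs.wordProd (l false) * cs.wordProd (l true)) (simpleRoot a) (m + i) =
        y * chebSeq (2 - 2 * μ) m := by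
  have hform := recurrence_eq_chebSeq (hl.orbitSeq_recurrence (cs := cs) hx hε (simpleRoot a))
  set g := orbitSeq cs ε x (cs.wordProd (l false) * cs.wordProd (l true)) (simpleRoot a) with hg
  have h0 : g 0 = if ε a = true then x a else 0 := by
    have := orbitSeq_even (cs := cs) (ε := ε) (x := x)
      (cs.wordProd (l false) * cs.wordProd (l true)) (simpleRoot a) 0
    rw [pow_zero, map_one, Module.End.one_apply, colorSum_simpleRoot] at this
    exact this
  have h1 : g 1 = if ε a = false then x a else 0 := by
    have := orbitSeq_odd (cs := cs) (ε := ε) (x := x)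
      (cs.wordProd (l false) * cs.wordProd (l true)) (simpleRoot a) 0
    rw [pow_zero, map_one, Module.End.one_apply, colorSum_simpleRoot] at this
    exact this
  have hxa := (hx.pos a ha).ne'
  cases hea : ε a with
  | false =>
    simp only [hea, if_true, Bool.false_eq_true, if_false] at h0 h1
    refine ⟨x a, hxa, 0, fun m => ?_⟩
    rw [add_zero]
    cases m with
    | zero => simp [h0, chebSeq]
    | succ m =>
      have := hform 0 m
      rw [zero_add, zero_add, h0, h1] at this
      rw [this]; ring
  | true =>
    simp only [hea, if_true, Bool.true_eq_false, if_false] at h0 h1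
    refine ⟨-x a, neg_ne_zero.mpr hxa, 1, fun m => ?_⟩
    have := hform 0 m
    rw [zero_add, zero_add, h0, h1] at this
    rw [this]; ring

include hx hε hl in
theorem IsBipartiteCover.exists_isHalfPeriod [Finite W] (cs : CoxeterSystem M W) {a : B}
    (ha : a ∈ K) : ∃ H, IsHalfPeriod (2 - 2 * μ) H := by
  obtain ⟨y, hy, i, hyi⟩ := hl.exists_orbitSeq_eq_chebSeq (cs := cs) hx hε ha
  have hcoh := hl.isCoherent (cs := cs) hx hε (isRootOf_simple cs a) (hx.simpleRoot_eq_zero ha)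
  set c := cs.wordProd (l false) * cs.wordProd (l true)
  refine _root_.exists_isHalfPeriod (fun m => ?_) (N := 2 * orderOf c)
    (by have := orderOf_pos c; omega) ?_
  · have h1 := hcoh.mul_nonneg (m + i)
    rw [show m + i + 1 = m + 1 + i by ring, hyi, hyi] at h1
    have h2 : 0 < y * y := mul_self_pos.mpr hy
    have h3 : 0 ≤ (y * y) * (chebSeq (2 - 2 * μ) m * chebSeq (2 - 2 * μ) (m + 1)) := by linarith
    exact nonneg_of_mul_nonneg_right h3 h2
  · have h1 := hyi 0
    rw [← orbitSeq_add_of_pow_eq_one (pow_orderOf_eq_one c), add_right_comm, hyi, zero_add] at h1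
    simpa [chebSeq] using mul_left_cancel₀ hy h1

include hx hε hl in
theorem IsBipartiteCover.orderOf_eq [Finite W] (hlK : ∀ e, ∀ a ∈ l e, a ∈ K) {a : B} (ha : a ∈ K)
    {H : ℕ} (hH : IsHalfPeriod (2 - 2 * μ) H) :
    orderOf (cs.wordProd (l false) * cs.wordProd (l true)) = H := by
  have hrec := hl.orbitSeq_recurrence (cs := cs) hx hε
  obtain ⟨y, hy, i, hyi⟩ := hl.exists_orbitSeq_eq_chebSeq (cs := cs) hx hε ha
  set c := cs.wordProd (l false) * cs.wordProd (l true) with hc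
  refine Nat.dvd_antisymm ?_ ?_
  · refine orderOf_dvd_of_pow_eq_one (eq_one_of_geomRep_nonneg cs _ fun b => ?_)
    by_cases hb : b ∈ K
    · rcases geomRep_simpleRoot_nonneg_or_nonpos cs (c ^ H) b with h | h
      · exact h
      · exfalso
        have h1 := fun m => hH.add_two_mul (hrec (simpleRoot b)) m 1
        have ht := h1 0
        have hf := h1 1
        rw [mul_one, zero_add, orbitSeq_even, show (0 : ℕ) = 2 * 0 by rfl, orbitSeq_even,
          pow_zero, map_one, Module.End.one_apply, colorSum_simpleRoot] at ht
        rw [mul_one, add_comm, orbitSeq_odd, show (1 : ℕ) = 2 * 0 + 1 by rfl, orbitSeq_odd,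
          pow_zero, map_one, Module.End.one_apply, colorSum_simpleRoot] at hf
        have h2 := hx.colorSum_nonneg ε true (neg_nonneg.mpr h)
        have h3 := hx.colorSum_nonneg ε false (neg_nonneg.mpr h)
        rw [colorSum_neg, ht] at h2
        rw [colorSum_neg, hf] at h3
        have hxb := hx.pos b hb
        cases hcol : ε b <;> simp [hcol] at h2 h3 <;> linarith
    · have hfix : geomRep cs c (simpleRoot b) = simpleRoot b := by
        have horth : ∀ e, ∀ d ∈ l e, coxGram M b d = 0 := by
          intro e d hd
          by_contra h0
          exact hb (hx.closed d (hlK e d hd) b (by rwa [coxGram_comm]))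
        rw [hc, map_mul, Module.End.mul_apply, geomRep_wordProd_simpleRoot _ (horth true),
          geomRep_wordProd_simpleRoot _ (horth false)]
      have : geomRep cs (c ^ H) (simpleRoot b) = simpleRoot b := by
        rw [map_pow, Module.End.pow_apply]
        exact Function.iterate_fixed hfix H
      rw [this]
      simp [simpleRoot, Pi.single_nonneg]
  · refine hH.dvd_of_periodic fun m => mul_left_cancel₀ hy ?_
    rw [← hyi, ← hyi, add_right_comm, orbitSeq_add_of_pow_eq_one (pow_orderOf_eq_one c)]

include hx hε hl in
/-- Along `H` consecutive conjugates by a bipartite Coxeter element, a reflection with root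
supported on `K` equals a simple reflection exactly twice. -/
theorem IsBipartiteCover.sum_card_eq_two [Finite W] [DecidableEq W] {t : W} {β : B → ℝ}
    (h : IsRootOf cs t β) (hK : ∀ a ∉ K, β a = 0) {H : ℕ} (hH : IsHalfPeriod (2 - 2 * μ) H) :
    ∑ k ∈ Finset.range H, (Finset.univ.filter fun s =>
      (cs.wordProd (l false) * cs.wordProd (l true)) ^ k * t *
        ((cs.wordProd (l false) * cs.wordProd (l true)) ^ k)⁻¹ = cs.simple s).card = 2 := by
  have hcoh := hl.isCoherent hx hε h hK
  set c := cs.wordProd (l false) * cs.wordProd (l true) with hc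
  refine Eq.trans ?_ (hH.sum_zeros hcoh)
  refine Finset.sum_congr rfl fun k _ => ?_
  rw [orbitSeq_even, orbitSeq_odd]
  have hk := h.conj (c ^ k)
  have hkK := hx.geomRep_apply_eq_zero (cs := cs) (c ^ k) hK
  simp only [hx.colorSum_eq_zero_iff_exists hε hk hkK]
  set t' := c ^ k * t * (c ^ k)⁻¹
  by_cases hex : ∃ s, t' = cs.simple s
  · obtain ⟨s, hs⟩ := hex
    have hiff : ∀ s', t' = cs.simple s' ↔ s' = s := by
      intro s'
      rw [hs]
      exact ⟨fun e => (simple_injective cs e).symm, fun e => by rw [e]⟩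
    simp only [hiff, exists_eq_right, Finset.filter_eq', Finset.mem_univ, if_true,
      Finset.card_singleton]
    cases ε s <;> simp
  · push Not at hex
    simp [hex]

end

theorem exists_isPerronVector [Finite W] (cs : CoxeterSystem M W) (s : B) :
    ∃ x μ, IsPerronVector M (coxComponent cs s) x μ := by
  obtain ⟨x, μ, h1, h2, h3⟩ := exists_positive_eigenvector cs s
  exact ⟨x, μ, h1, h2, fun a ha b => mem_coxComponent_of_coxGram_ne_zero cs ha, h3⟩

theorem coxComponent_eq_of_mem [Finite W] {s a : B} (h : a ∈ coxComponent cs s) :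
    coxComponent cs a = coxComponent cs s := by
  have hsymm : ∀ a b : B, Relation.ReflTransGen (coxAdj cs) a b →
      Relation.ReflTransGen (coxAdj cs) b a := by
    intro a b hab
    induction hab with
    | refl => exact Relation.ReflTransGen.refl
    | tail _ h ih => exact Relation.ReflTransGen.head (coxAdj_symm cs h) ih
  ext b
  exact ⟨fun hb => Relation.ReflTransGen.trans h hb,
    fun hb => Relation.ReflTransGen.trans (hsymm _ _ h) hb⟩

theorem orderOf_eq_of_isConj {G : Type*} [Group G] {a b : G} (h : IsConj a b) :
    orderOf a = orderOf b := by
  obtain ⟨g, rfl⟩ := isConj_iff.mp h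
  exact (orderOf_injective (MulAut.conj g).toMonoidHom (MulAut.conj g).injective a).symm

/-- Let `h s` be the order of a Coxeter element `l' s` of the component of `s`. Every reflection
meets the simple reflections exactly twice among its conjugates by a bipartite Coxeter element,
where conjugation by the `k`-th power is counted against `s` only for `k < h s`. -/
theorem sum_card_conj_eq_two [Finite W] [DecidableEq W] (cs : CoxeterSystem M W)
    {ε : B → Bool} (hε : ∀ a b, a ≠ b → coxGram M a b ≠ 0 → ε a ≠ ε b)
    {l : Bool → List B} (hl : IsBipartiteCover ε Set.univ l) (l' : B → List B)
    (hnd : ∀ s, (l' s).Nodup) (hmem : ∀ s a, a ∈ l' s ↔ a ∈ coxComponent cs s)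
    {t : W} (ht : IsReflectionOf (simpleSet cs) t) :
    ∑ s, ((Finset.range (orderOf (cs.wordProd (l' s)))).filter fun k =>
      (cs.wordProd (l false) * cs.wordProd (l true)) ^ k * t *
        ((cs.wordProd (l false) * cs.wordProd (l true)) ^ k)⁻¹ = cs.simple s).card = 2 := by
  obtain ⟨w, _, ⟨a, rfl⟩, htw⟩ := ht
  obtain ⟨x, μ, hx⟩ := exists_isPerronVector cs a
  have ha := mem_coxComponent_self cs a
  have hlK := hl.mono (Set.subset_univ (coxComponent cs a))
  have hroot : IsRootOf cs t (geomRep cs w (simpleRoot a)) := ⟨w, a, htw, rfl⟩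
  have hsupp := hx.geomRep_apply_eq_zero (cs := cs) w (hx.simpleRoot_eq_zero ha)
  obtain ⟨H, hH⟩ := hlK.exists_isHalfPeriod hx hε cs ha
  rw [← hlK.sum_card_eq_two hx hε hroot hsupp hH]
  simp only [Finset.card_filter]
  rw [Finset.sum_comm' (t' := Finset.univ) (s' := fun _ => Finset.range H) (by simp)]
  refine Finset.sum_congr rfl fun s _ => ?_
  by_cases hs : s ∈ coxComponent cs a
  · suffices h : orderOf (cs.wordProd (l' s)) = H by rw [h]
    obtain ⟨l₀, hl₀, hl₀K⟩ := exists_isBipartiteCover ε (coxComponent cs a)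
    rw [← hl₀.orderOf_eq (cs := cs) hx hε hl₀K ha hH, ← cs.wordProd_append]
    refine orderOf_eq_of_isConj (isConj_wordProd_of_perm cs (hnd s) ?_)
    have hnd₀ : (l₀ false ++ l₀ true).Nodup := by
      refine List.nodup_append.mpr ⟨hl₀.nodup _, hl₀.nodup _, ?_⟩
      rintro b hb _ hb' rfl
      have := hl₀.color _ b hb
      rw [hl₀.color _ b hb'] at this
      simp at this
    rw [List.perm_ext_iff_of_nodup (hnd s) hnd₀]
    intro b
    rw [hmem, coxComponent_eq_of_mem hs, List.mem_append]
    constructor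
    · intro hb
      have := hl₀.mem b hb
      cases hc : ε b <;> rw [hc] at this <;> tauto
    · rintro (hb | hb)
      · exact hl₀K _ b hb
      · exact hl₀K _ b hb
  · have hne : ∀ k, (cs.wordProd (l false) * cs.wordProd (l true)) ^ k * t *
        ((cs.wordProd (l false) * cs.wordProd (l true)) ^ k)⁻¹ ≠ cs.simple s := by
      intro k e
      have h1 := hroot.conj ((cs.wordProd (l false) * cs.wordProd (l true)) ^ k)
      have h2 := hx.geomRep_apply_eq_zero (cs := cs)
        ((cs.wordProd (l false) * cs.wordProd (l true)) ^ k) hsupp s hs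
      rcases (h1.eq_iff (isRootOf_simple cs s)).mp e with h3 | h3 <;> rw [h3] at h2 <;>
        simp [simpleRoot] at h2
    simp [hne]

end CoxeterNumber

section Factorization

variable {G : Type*} [Group G]

/-- Every element is a product of reflections. -/
def ReflectionsGenerate (S : Set G) : Prop :=
  ∀ g : G, ∃ l : List G, (∀ t ∈ l, IsReflectionOf S t) ∧ l.prod = g

theorem reflectionsGenerate_of_closure_eq_top {S : Set G} (h : Subgroup.closure S = ⊤)
    (hsq : ∀ s ∈ S, s * s = 1) : ReflectionsGenerate S := by
  intro g
  have hg : g ∈ Subgroup.closure S := h ▸ Subgroup.mem_top g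
  rw [← Subgroup.mem_toSubmonoid, Subgroup.closure_toSubmonoid] at hg
  obtain ⟨l, hl, rfl⟩ := Submonoid.exists_list_of_mem_closure hg
  refine ⟨l, fun t ht => ⟨1, t, ?_, by simp⟩, rfl⟩
  rcases hl t ht with h | h
  · exact h
  · have := hsq _ h
    rw [← mul_inv_rev, inv_eq_one] at this
    rwa [Set.mem_inv, inv_eq_of_mul_eq_one_left this] at h

theorem IsReflectionOf.conj {S : Set G} {t : G} (h : IsReflectionOf S t) (g : G) :
    IsReflectionOf S (g * t * g⁻¹) := by
  obtain ⟨w, s, hs, rfl⟩ := h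
  exact ⟨g * w, s, hs, by group⟩

theorem absLength_le {S : Set G} (l : List G) (hl : ∀ t ∈ l, IsReflectionOf S t) :
    absLength S l.prod ≤ l.length :=
  Nat.sInf_le ⟨l, hl, rfl, rfl⟩

theorem absLength_one (S : Set G) : absLength S 1 = 0 :=
  Nat.le_zero.mp (absLength_le (S := S) [] (by simp))

theorem ReflectionsGenerate.exists_list {S : Set G} (h : ReflectionsGenerate S) (g : G) :
    ∃ l : List G, (∀ t ∈ l, IsReflectionOf S t) ∧ l.length = absLength S g ∧ l.prod = g := by
  obtain ⟨l, hl, hp⟩ := h g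
  exact Nat.sInf_mem (s := {k | ∃ l : List G, (∀ t ∈ l, IsReflectionOf S t) ∧ l.length = k ∧
    l.prod = g}) ⟨l.length, l, hl, rfl, hp⟩

theorem ReflectionsGenerate.absLength_mul_le {S : Set G} (h : ReflectionsGenerate S) (g g' : G) :
    absLength S (g * g') ≤ absLength S g + absLength S g' := by
  obtain ⟨l, hl, hlen, hp⟩ := h.exists_list g
  obtain ⟨l', hl', hlen', hp'⟩ := h.exists_list g'
  rw [← hlen, ← hlen', ← List.length_append, ← hp, ← hp', ← List.prod_append]
  refine absLength_le _ fun t ht => ?_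
  rcases List.mem_append.mp ht with ht | ht
  · exact hl t ht
  · exact hl' t ht

theorem absLength_conj (S : Set G) (g w : G) : absLength S (g * w * g⁻¹) = absLength S w := by
  have key : ∀ g w : G, ∀ k, (∃ l : List G, (∀ t ∈ l, IsReflectionOf S t) ∧ l.length = k ∧
      l.prod = w) → ∃ l : List G, (∀ t ∈ l, IsReflectionOf S t) ∧ l.length = k ∧
      l.prod = g * w * g⁻¹ := by
    rintro g w k ⟨l, hl, hk, rfl⟩
    refine ⟨l.map (MulAut.conj g), ?_, by simpa using hk, ?_⟩
    · intro t ht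
      obtain ⟨t', ht', rfl⟩ := List.mem_map.mp ht
      exact (hl t' ht').conj g
    · rw [← map_list_prod, MulAut.conj_apply]
  unfold absLength
  congr 1
  ext k
  refine ⟨fun h => ?_, key g w k⟩
  have := key g⁻¹ _ k h
  rwa [show g⁻¹ * (g * w * g⁻¹) * g⁻¹⁻¹ = w by group] at this

theorem ReflectionsGenerate.absLength_eq_one_iff {S : Set G} (h : ReflectionsGenerate S)
    (h1 : ¬ IsReflectionOf S 1) (t : G) : absLength S t = 1 ↔ IsReflectionOf S t := by
  constructor
  · intro ht
    obtain ⟨l, hl, hlen, rfl⟩ := h.exists_list t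
    obtain ⟨a, rfl⟩ := List.length_eq_one_iff.mp (hlen.trans ht)
    simpa using hl
  · intro ht
    have h2 : absLength S t ≤ 1 := by
      simpa using absLength_le (S := S) [t] (by simpa using ht)
    have h3 : absLength S t ≠ 0 := by
      intro h0
      obtain ⟨l, hl, hlen, rfl⟩ := h.exists_list t
      obtain rfl := List.length_eq_zero_iff.mp (hlen.trans h0)
      exact h1 ht
    omega

section

variable [Fintype G] [DecidableEq G]

/-- The number of factorizations of `c` into factors with prescribed values of `ℓ`. -/
def factCount (ℓ : G → ℕ) : {m : ℕ} → (Fin m → ℕ) → G → ℕ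
  | 0, _, c => if c = 1 then 1 else 0
  | _ + 1, j, c => ∑ w with ℓ w = j 0, factCount ℓ (fun i => j i.succ) (w⁻¹ * c)

theorem factCount_conj {ℓ : G → ℕ} (hℓ : ∀ g w, ℓ (g * w * g⁻¹) = ℓ w) {m : ℕ} (j : Fin m → ℕ)
    (g c : G) : factCount ℓ j (g * c * g⁻¹) = factCount ℓ j c := by
  induction m generalizing c with
  | zero => simp [factCount]
  | succ m ih =>
    rw [factCount, factCount]
    refine (Finset.sum_equiv (MulAut.conj g).toEquiv ?_ ?_).symm
    · intro w
      simp [hℓ]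
    · intro w _
      rw [← ih]
      congr 1
      simp [mul_assoc]

theorem factCount_eq_of_isConj {ℓ : G → ℕ} (hℓ : ∀ g w, ℓ (g * w * g⁻¹) = ℓ w) {m : ℕ}
    (j : Fin m → ℕ) {c c' : G} (h : IsConj c c') : factCount ℓ j c = factCount ℓ j c' := by
  obtain ⟨g, rfl⟩ := isConj_iff.mp h
  exact (factCount_conj hℓ j g c).symm

/-- A factor of a factorization may be moved to the front. -/
theorem factCount_eq_sum_succAbove {ℓ : G → ℕ} (hℓ : ∀ g w, ℓ (g * w * g⁻¹) = ℓ w) {m : ℕ}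
    (j : Fin (m + 1) → ℕ) (i : Fin (m + 1)) (c : G) :
    factCount ℓ j c = ∑ t with ℓ t = j i, factCount ℓ (j ∘ i.succAbove) (t⁻¹ * c) := by
  induction m generalizing c with
  | zero =>
    obtain rfl : i = 0 := Fin.eq_zero i
    rw [factCount]
    rfl
  | succ m ih =>
    cases i using Fin.cases with
    | zero =>
      rw [factCount]
      refine Finset.sum_congr rfl fun w _ => ?_
      congr 1
    | succ i =>
      rw [factCount, Finset.sum_congr rfl fun w _ => ih _ i (w⁻¹ * c)]
      simp only [factCount]
      rw [Finset.sum_comm' (s := Finset.univ.filter fun t => ℓ t = j i.succ)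
        (t' := Finset.univ.filter fun w => ℓ w = j 0)
        (s' := fun _ => Finset.univ.filter fun t => ℓ t = j i.succ)]
      · refine Finset.sum_congr ?_ fun w _ => ?_
        · simp
        · refine Finset.sum_equiv (MulAut.conj w).toEquiv ?_ ?_
          · intro t
            simp [hℓ]
          · intro t _
            congr 1
            · funext x
              simp
            · simp [mul_assoc]
      · intro t w
        simp

theorem le_sum_of_factCount_ne_zero {ℓ : G → ℕ} (h1 : ℓ 1 = 0)
    (hmul : ∀ g g', ℓ (g * g') ≤ ℓ g + ℓ g') {m : ℕ} (j : Fin m → ℕ) {c : G}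
    (h : factCount ℓ j c ≠ 0) : ℓ c ≤ ∑ i, j i := by
  induction m generalizing c with
  | zero =>
    by_cases hc : c = 1
    · simp [hc, h1]
    · simp [factCount, hc] at h
  | succ m ih =>
    rw [factCount] at h
    obtain ⟨w, hw, hne⟩ := Finset.exists_ne_zero_of_sum_ne_zero h
    have h2 := ih _ hne
    have h3 := hmul w (w⁻¹ * c)
    rw [mul_inv_cancel_left, (Finset.mem_filter.mp hw).2] at h3
    rw [Fin.sum_univ_succ]
    omega

theorem card_steps_eq_factCount (ℓ : G → ℕ) {m : ℕ} (j : Fin m → ℕ) (x c : G) :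
    Nat.card {y : Fin (m + 1) → G // y 0 = x ∧ y (Fin.last m) = c ∧
      ∀ i : Fin m, ℓ ((y i.castSucc)⁻¹ * y i.succ) = j i} = factCount ℓ j (x⁻¹ * c) := by
  induction m generalizing x with
  | zero =>
    rw [factCount]
    split_ifs with h
    · rw [inv_mul_eq_one] at h
      subst h
      rw [Nat.card_eq_one_iff_unique]
      refine ⟨⟨fun y y' => Subtype.ext (funext fun i => ?_)⟩, ⟨⟨fun _ => x, rfl, rfl, by simp⟩⟩⟩
      rw [Fin.eq_zero i, y.2.1, y'.2.1]
    · rw [Nat.card_eq_zero]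
      refine Or.inl ⟨fun y => h ?_⟩
      rw [inv_mul_eq_one]
      exact y.2.1.symm.trans y.2.2.1
  | succ m ih =>
    rw [factCount]
    let e : {y : Fin (m + 1 + 1) → G // y 0 = x ∧ y (Fin.last (m + 1)) = c ∧
          ∀ i : Fin (m + 1), ℓ ((y i.castSucc)⁻¹ * y i.succ) = j i} ≃
        Σ w : {w : G // ℓ w = j 0}, {y : Fin (m + 1) → G // y 0 = x * w ∧ y (Fin.last m) = c ∧
          ∀ i : Fin m, ℓ ((y i.castSucc)⁻¹ * y i.succ) = j i.succ} :=
      { toFun := fun y => ⟨⟨x⁻¹ * y.1 1, by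
            have := y.2.2.2 0
            rwa [Fin.castSucc_zero, y.2.1] at this⟩,
          ⟨fun i => y.1 i.succ, by simp, y.2.2.1,
            fun i => y.2.2.2 i.succ⟩⟩
        invFun := fun p => ⟨Fin.cons x p.2.1, by simp, by
            rw [← Fin.succ_last, Fin.cons_succ]; exact p.2.2.2.1, by
            intro i
            cases i using Fin.cases with
            | zero =>
              rw [Fin.castSucc_zero, Fin.cons_zero, Fin.cons_succ, p.2.2.1, inv_mul_cancel_left]
              exact p.1.2
            | succ i =>
              rw [Fin.castSucc_succ, Fin.cons_succ, Fin.cons_succ]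
              exact p.2.2.2.2 i⟩
        left_inv := by
          rintro ⟨y, rfl, hy⟩
          refine Subtype.ext (funext fun i => ?_)
          cases i using Fin.cases <;> simp
        right_inv := by
          rintro ⟨⟨w, hw⟩, ⟨y, hy, hy'⟩⟩
          have hw' : x⁻¹ * y 0 = w := by rw [hy, inv_mul_cancel_left]
          subst hw'
          rfl }
    rw [Nat.card_congr e, Nat.card_sigma, Finset.sum_subtype (p := fun w => ℓ w = j 0) _ (by simp)]
    refine Finset.sum_congr rfl fun w _ => ?_
    rw [ih, mul_inv_rev, mul_assoc]

theorem ReflectionsGenerate.chainCount_eq_factCount {S : Set G} (h : ReflectionsGenerate S)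
    {m : ℕ} (j : Fin m → ℕ) {c : G} (hsum : ∑ i, j i = absLength S c) :
    chainCount S c j = factCount (absLength S) j c := by
  have hcount := card_steps_eq_factCount (absLength S) j 1 c
  rw [inv_one, one_mul] at hcount
  rw [← hcount]
  refine Nat.card_congr (Equiv.subtypeEquivRight fun y => ?_)
  constructor
  · rintro ⟨h0, h1, -, hle, hlen⟩
    refine ⟨h0, h1, fun i => ?_⟩
    have h2 := hle i
    rw [absLe, hlen i] at h2
    omega
  · rintro ⟨h0, h1, hstep⟩
    have hlast : Fin.partialSum j (Fin.last m) = absLength S c := by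
      rw [← hsum, ← List.sum_ofFn, Fin.partialSum]
      congr 1
      exact List.take_of_length_le (by simp)
    have hlow : ∀ i, absLength S (y i) ≤ Fin.partialSum j i := by
      intro i
      induction i using Fin.induction with
      | zero => rw [h0, absLength_one]; exact Nat.zero_le _
      | succ i ih =>
        have := h.absLength_mul_le (y i.castSucc) ((y i.castSucc)⁻¹ * y i.succ)
        rw [mul_inv_cancel_left, hstep] at this
        rw [Fin.partialSum_succ]
        omega
    have hhigh : ∀ i, absLength S ((y i)⁻¹ * c) + Fin.partialSum j i ≤ absLength S c := by
      intro i
      induction i using Fin.reverseInduction with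
      | last => rw [h1, inv_mul_cancel, absLength_one, hlast, zero_add]
      | cast i ih =>
        have := h.absLength_mul_le ((y i.castSucc)⁻¹ * y i.succ) ((y i.succ)⁻¹ * c)
        rw [mul_assoc, mul_inv_cancel_left, hstep] at this
        rw [Fin.partialSum_succ] at ih
        omega
    have htri : ∀ i, absLength S c ≤ absLength S (y i) + absLength S ((y i)⁻¹ * c) := by
      intro i
      simpa using h.absLength_mul_le (y i) ((y i)⁻¹ * c)
    have heq : ∀ i, absLength S (y i) = Fin.partialSum j i := fun i => by
      have := hlow i; have := hhigh i; have := htri i; omega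
    refine ⟨h0, h1, fun i => ?_, fun i => ?_, fun i => ?_⟩
    · have := hlow i; have := hhigh i; have := htri i
      rw [absLe]
      omega
    · rw [absLe, hstep, heq, heq, Fin.partialSum_succ]
    · rw [heq, heq, Fin.partialSum_succ]

end

section

variable [Fintype G] [DecidableEq G] {S : Set G} {H : Subgroup G} {S' : Set H}

/-- Every shortest reflection factorization of `c` uses only reflections of the subgroup `H`. -/
def ReducedWordsIn (S : Set G) (S' : Set H) (c : G) : Prop :=
  ∀ l : List G, (∀ t ∈ l, IsReflectionOf S t) → l.prod = c → l.length = absLength S c →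
    ∀ t ∈ l, ∃ h : t ∈ H, IsReflectionOf S' ⟨t, h⟩

theorem ReducedWordsIn.mem_and_absLength_le (hgen : ReflectionsGenerate S) {c : G}
    (hc : ReducedWordsIn S S' c) : ∃ h : c ∈ H, absLength S' ⟨c, h⟩ ≤ absLength S c := by
  obtain ⟨l, hl, hlen, hp⟩ := hgen.exists_list c
  have hin := hc l hl hp hlen
  have hval : (l.attach.map fun t => (⟨t.1, (hin t.1 t.2).1⟩ : H)).prod = c := by
    rw [Subgroup.val_list_prod, List.map_map]
    simpa [Function.comp_def] using hp
  refine ⟨hval ▸ SetLike.coe_mem _, ?_⟩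
  have : (⟨c, hval ▸ SetLike.coe_mem _⟩ : H) =
      (l.attach.map fun t => (⟨t.1, (hin t.1 t.2).1⟩ : H)).prod := Subtype.ext hval.symm
  rw [this, ← hlen]
  refine (absLength_le _ ?_).trans (by simp)
  intro t ht
  obtain ⟨t', -, rfl⟩ := List.mem_map.mp ht
  exact (hin t'.1 t'.2).2

theorem absLength_coe_le (hgen' : ReflectionsGenerate S') (hS : ∀ s ∈ S', (s : G) ∈ S) (x : H) :
    absLength S (x : G) ≤ absLength S' x := by
  obtain ⟨l, hl, hlen, hp⟩ := hgen'.exists_list x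
  rw [← hlen, ← hp, Subgroup.val_list_prod, ← List.length_map (f := ((↑) : H → G))]
  refine absLength_le _ fun t ht => ?_
  obtain ⟨t', ht', rfl⟩ := List.mem_map.mp ht
  obtain ⟨g, s, hs, rfl⟩ := hl t' ht'
  exact ⟨g, s, hS s hs, by simp⟩

theorem ReducedWordsIn.of_mul (hgen : ReflectionsGenerate S) {w v : G}
    (h : ReducedWordsIn S S' (w * v))
    (hlen : absLength S (w * v) = absLength S w + absLength S v) :
    ReducedWordsIn S S' w ∧ ReducedWordsIn S S' v := by
  obtain ⟨lw, hlw, hlenw, hpw⟩ := hgen.exists_list w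
  obtain ⟨lv, hlv, hlenv, hpv⟩ := hgen.exists_list v
  refine ⟨fun l hl hp hll t ht => ?_, fun l hl hp hll t ht => ?_⟩
  · refine h (l ++ lv) ?_ (by rw [List.prod_append, hp, hpv])
      (by rw [List.length_append, hlen, hll, hlenv]) t (by simp [ht])
    intro t ht
    exact (List.mem_append.mp ht).elim (hl t) (hlv t)
  · refine h (lw ++ l) ?_ (by rw [List.prod_append, hp, hpw])
      (by rw [List.length_append, hlen, hll, hlenw]) t (by simp [ht])
    intro t ht
    exact (List.mem_append.mp ht).elim (hlw t) (hl t)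

theorem ReducedWordsIn.factCount_eq [Fintype H] (hgen : ReflectionsGenerate S)
    (hgen' : ReflectionsGenerate S')
    (hS : ∀ s ∈ S', (s : G) ∈ S) {m : ℕ} (j : Fin m → ℕ) {x : H}
    (hx : ReducedWordsIn S S' (x : G)) (hsum : ∑ i, j i = absLength S (x : G)) :
    factCount (absLength S') j x = factCount (absLength S) j (x : G) := by
  induction m generalizing x with
  | zero => simp [factCount]
  | succ m ih =>
    rw [factCount, factCount]
    rw [Fin.sum_univ_succ] at hsum
    have hle := absLength_coe_le (S := S) hgen' hS
    have hcoe : ∀ w : H, absLength S (w : G) = j 0 →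
        absLength S ((w⁻¹ * x : H) : G) ≤ ∑ i : Fin m, j i.succ →
        ReducedWordsIn S S' (w : G) ∧ ReducedWordsIn S S' ((w⁻¹ * x : H) : G) ∧
          ∑ i : Fin m, j i.succ = absLength S ((w⁻¹ * x : H) : G) := by
      intro w hw h
      have h1 := hgen.absLength_mul_le (w : G) ((w⁻¹ * x : H) : G)
      have h2 : (w : G) * ((w⁻¹ * x : H) : G) = x := by simp
      rw [h2] at h1
      have h3 := ReducedWordsIn.of_mul (S' := S') hgen (w := (w : G)) (v := ((w⁻¹ * x : H) : G))
        (by rwa [h2]) (by rw [h2]; omega)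
      exact ⟨h3.1, h3.2, by omega⟩
    have hH : ∀ w : H, absLength S' w = j 0 →
        factCount (absLength S') (fun i : Fin m => j i.succ) (w⁻¹ * x) ≠ 0 →
        absLength S (w : G) = j 0 ∧ absLength S ((w⁻¹ * x : H) : G) ≤ ∑ i : Fin m, j i.succ := by
      intro w hw hne
      have h1 := le_sum_of_factCount_ne_zero (absLength_one S') hgen'.absLength_mul_le _ hne
      have h2 := hgen.absLength_mul_le (w : G) ((w⁻¹ * x : H) : G)
      rw [show (w : G) * ((w⁻¹ * x : H) : G) = x by simp] at h2
      have h3 := hle w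
      have h4 := hle (w⁻¹ * x)
      exact ⟨by omega, by omega⟩
    refine Finset.sum_bij_ne_zero (fun w _ _ => (w : G)) ?_ ?_ ?_ ?_
    · intro w hw hne
      simpa using (hH w (by simpa using hw) hne).1
    · intro w _ _ w' _ _ h
      exact Subtype.ext h
    · intro w hw hne
      have hw' : absLength S w = j 0 := by simpa using hw
      have h1 := le_sum_of_factCount_ne_zero (absLength_one S) hgen.absLength_mul_le _ hne
      have h2 := hgen.absLength_mul_le w (w⁻¹ * x)
      rw [mul_inv_cancel_left] at h2
      have hred := ReducedWordsIn.of_mul (S' := S') hgen (w := w) (v := w⁻¹ * x)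
        (by rwa [mul_inv_cancel_left]) (by rw [mul_inv_cancel_left]; omega)
      obtain ⟨hwH, hwle⟩ := hred.1.mem_and_absLength_le hgen
      have h3 := hle ⟨w, hwH⟩
      refine ⟨⟨w, hwH⟩, ?_, ?_, rfl⟩
      · simp only [Finset.mem_filter, Finset.mem_univ, true_and]
        change absLength S w ≤ _ at h3
        omega
      · rw [ih _ (hcoe ⟨w, hwH⟩ hw' h1).2.1 (hcoe ⟨w, hwH⟩ hw' h1).2.2]
        exact hne
    · intro w hw hne
      obtain ⟨h1, h2⟩ := hH w (by simpa using hw) hne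
      obtain ⟨-, h3, h4⟩ := hcoe w h1 h2
      rw [ih _ h3 h4]
      simp

end

end Factorization

section ChainCount

variable {B : Type*} [Fintype B] [DecidableEq B] {M : CoxeterMatrix B}
  {W : Type*} [Group W] (cs : CoxeterSystem M W)

theorem reflectionsGenerate_simpleSet : ReflectionsGenerate (simpleSet cs) := by
  refine reflectionsGenerate_of_closure_eq_top cs.subgroup_closure_range_simple ?_
  rintro _ ⟨a, rfl⟩
  exact cs.simple_mul_simple_self a

theorem reflectionsGenerate_parabolicGens (s : B) : ReflectionsGenerate (parabolicGens cs s) := by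
  refine reflectionsGenerate_of_closure_eq_top (Subgroup.closure_closure_coe_preimage) ?_
  rintro x ⟨⟨a, ha⟩, -⟩
  refine Subtype.ext ?_
  rw [Subgroup.coe_mul, ← ha, cs.simple_mul_simple_self, Subgroup.coe_one]

theorem isReflectionOf_simple (a : B) : IsReflectionOf (simpleSet cs) (cs.simple a) :=
  ⟨1, _, ⟨a, rfl⟩, by simp⟩

theorem not_isReflectionOf_one [Finite W] : ¬ IsReflectionOf (simpleSet cs) 1 := by
  intro h
  obtain ⟨β, hβ⟩ := exists_isRootOf cs h
  exact hβ.ne_one rfl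

theorem IsReflectionOf.inv_eq {t : W} (h : IsReflectionOf (simpleSet cs) t) : t⁻¹ = t := by
  obtain ⟨g, _, ⟨a, rfl⟩, rfl⟩ := h
  simp [mul_assoc]

theorem absLength_wordProd_le (l : List B) :
    absLength (simpleSet cs) (cs.wordProd l) ≤ l.length := by
  rw [CoxeterSystem.wordProd, ← List.length_map (f := cs.simple) (as := l)]
  refine absLength_le _ fun t ht => ?_
  obtain ⟨a, -, rfl⟩ := List.mem_map.mp ht
  exact isReflectionOf_simple cs a

theorem length_eq_card {l : List B} (hl : l.Nodup) (hall : ∀ a, a ∈ l) :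
    l.length = Fintype.card B := by
  rw [← List.toFinset_card_of_nodup hl, ← Finset.card_univ]
  congr 1
  ext a
  simp [hall]

theorem absLength_wordProd_eq_card [Finite W] {l : List B} (hl : l.Nodup) (hall : ∀ a, a ∈ l) :
    absLength (simpleSet cs) (cs.wordProd l) = Fintype.card B := by
  obtain ⟨L, hL, hlen, hp⟩ := (reflectionsGenerate_simpleSet cs).exists_list (cs.wordProd l)
  refine le_antisymm ?_ ?_
  · rw [← length_eq_card hl hall]
    exact absLength_wordProd_le cs l
  · rw [← hlen]
    exact card_le_length_of_prod_eq cs l hl hall L hL hp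

theorem absLength_wordProd_add_one [Finite W] {s : B} {l : List B} (hl : l.Nodup)
    (hmem : ∀ a, a ∈ l ↔ a ≠ s) :
    absLength (simpleSet cs) (cs.wordProd l) + 1 = Fintype.card B := by
  have hs : s ∉ l := fun h => (hmem s).mp h rfl
  have hnd : (s :: l).Nodup := List.nodup_cons.mpr ⟨hs, hl⟩
  have hall : ∀ a, a ∈ s :: l := fun a => by
    rw [List.mem_cons, hmem]; exact em _
  have h1 := absLength_wordProd_le cs l
  have h2 := length_eq_card hnd hall
  rw [List.length_cons] at h2
  obtain ⟨L, hL, hlen, hp⟩ := (reflectionsGenerate_simpleSet cs).exists_list (cs.wordProd l)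
  have h3 := card_le_length_of_prod_eq cs (s :: l) hnd hall (cs.simple s :: L)
    (by
      intro t ht
      rcases List.mem_cons.mp ht with rfl | ht
      · exact isReflectionOf_simple cs s
      · exact hL t ht)
    (by rw [List.prod_cons, hp, cs.wordProd_cons])
  rw [List.length_cons] at h3
  omega

theorem simple_mem_parabolic [Finite W] {a s : B} (h : a ≠ s) : cs.simple a ∈ parabolic cs s :=
  Subgroup.subset_closure ⟨⟨a, rfl⟩, fun e => h (simple_injective cs e)⟩

theorem simple_mem_parabolicGens [Finite W] {a s : B} (h : a ≠ s) :
    (⟨cs.simple a, simple_mem_parabolic cs h⟩ : parabolic cs s) ∈ parabolicGens cs s :=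
  ⟨⟨a, rfl⟩, fun e => h (simple_injective cs e)⟩

theorem reducedWordsIn_parabolicGens [Finite W] {s : B} {l : List B} (hl : l.Nodup)
    (hmem : ∀ a, a ∈ l ↔ a ≠ s) :
    ReducedWordsIn (simpleSet cs) (parabolicGens cs s) (cs.wordProd l) := by
  intro L hL hp hlen t ht
  have h1 := absLength_wordProd_add_one cs hl hmem
  obtain ⟨u, hu, b, hb, rfl⟩ := exists_parabolic_conj_of_prod_eq cs l hl
    (fun a ha => (hmem a).mpr ha) L hL hp (by omega) t ht
  have hbm := simple_mem_parabolic cs hb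
  exact ⟨mul_mem (mul_mem hu hbm) (inv_mem hu), ⟨u, hu⟩, ⟨_, hbm⟩,
    simple_mem_parabolicGens cs hb, rfl⟩

theorem chainCount_parabolicGens [Fintype W] [DecidableEq W] {s : B} {l : List B} (hl : l.Nodup)
    (hmem : ∀ a, a ∈ l ↔ a ≠ s) {x : parabolic cs s} (hx : cs.wordProd l = x) {m : ℕ}
    (j : Fin m → ℕ) (hsum : ∑ i, j i + 1 = Fintype.card B) :
    chainCount (parabolicGens cs s) x j =
      factCount (absLength (simpleSet cs)) j (cs.wordProd l) := by
  classical
  have hgen := reflectionsGenerate_simpleSet cs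
  have hgen' := reflectionsGenerate_parabolicGens cs s
  have hS : ∀ y ∈ parabolicGens cs s, (y : W) ∈ simpleSet cs := fun y hy => hy.1
  have hred := reducedWordsIn_parabolicGens cs hl hmem
  have hlen := absLength_wordProd_add_one cs hl hmem
  rw [hx] at hred hlen ⊢
  have : Fintype (parabolic cs s) := Fintype.ofFinite _
  have hle : absLength (parabolicGens cs s) x ≤ absLength (simpleSet cs) (x : W) :=
    (hred.mem_and_absLength_le hgen).2
  have hge := absLength_coe_le (S := simpleSet cs) hgen' hS x
  rw [hgen'.chainCount_eq_factCount j (by omega)]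
  exact hred.factCount_eq hgen hgen' hS j (by omega)

theorem wordProd_eq_simple_mul_erase {l : List B} {s : B} (hs : s ∈ l)
    (hcomm : ∀ a ∈ l, ∀ b ∈ l, Commute (cs.simple a) (cs.simple b)) :
    cs.wordProd l = cs.simple s * cs.wordProd (l.erase s) := by
  rw [← cs.wordProd_cons, CoxeterSystem.wordProd, CoxeterSystem.wordProd]
  refine List.Perm.prod_eq' ((List.perm_cons_erase hs).map _) ?_
  refine List.pairwise_of_forall_mem_list ?_
  intro x hx y hy
  obtain ⟨a, ha, rfl⟩ := List.mem_map.mp hx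
  obtain ⟨b, hb, rfl⟩ := List.mem_map.mp hy
  exact hcomm a ha b hb

/-- Removing a simple reflection from a bipartite Coxeter element. -/
theorem IsBipartiteCover.isConj_simple_mul [Finite W] {ε : B → Bool}
    (hε : ∀ a b, a ≠ b → coxGram M a b ≠ 0 → ε a ≠ ε b) {l : Bool → List B}
    (hl : IsBipartiteCover ε Set.univ l) {s : B} {l' : List B} (hnd : l'.Nodup)
    (hmem : ∀ a, a ∈ l' ↔ a ≠ s) :
    IsConj (cs.simple s * (cs.wordProd (l false) * cs.wordProd (l true))) (cs.wordProd l') := by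
  have hcomm : ∀ e, ∀ a ∈ l e, ∀ b ∈ l e, Commute (cs.simple a) (cs.simple b) := by
    intro e a ha b hb
    by_cases hab : a = b
    · rw [hab]
    · refine commute_simple_of_coxGram_eq_zero cs ?_
      by_contra h
      exact hε a b hab h (by rw [hl.color e a ha, hl.color e b hb])
  have hdisj : ∀ a ∈ l false, a ∉ l true := by
    intro a ha ha'
    have := hl.color _ a ha
    rw [hl.color _ a ha'] at this
    simp at this
  have hcov : ∀ a, a ∈ l false ∨ a ∈ l true := by
    intro a
    have := hl.mem a (Set.mem_univ a)
    cases h : ε a <;> rw [h] at this <;> tauto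
  have hs := hl.mem s (Set.mem_univ s)
  cases hc : ε s with
  | false =>
    rw [hc] at hs
    rw [wordProd_eq_simple_mul_erase cs hs (hcomm false), mul_assoc,
      cs.simple_mul_simple_cancel_left, ← cs.wordProd_append]
    have hnd' : ((l false).erase s ++ l true).Nodup :=
      List.nodup_append'.mpr ⟨(hl.nodup _).erase _, hl.nodup _,
        fun a ha ha' => hdisj a (List.mem_of_mem_erase ha) ha'⟩
    refine isConj_wordProd_of_perm cs hnd' ((List.perm_ext_iff_of_nodup hnd' hnd).mpr fun a => ?_)
    rw [List.mem_append, (hl.nodup _).mem_erase_iff, hmem]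
    have := hcov a
    have h2 : a = s → a ∉ l true := fun h => h ▸ hdisj s hs
    tauto
  | true =>
    rw [hc] at hs
    have hconj : IsConj (cs.simple s * (cs.wordProd (l false) * cs.wordProd (l true)))
        (cs.wordProd (l true) * cs.simple s * cs.wordProd (l false)) :=
      isConj_iff.mpr ⟨cs.wordProd (l true), by group⟩
    refine hconj.trans ?_
    have hrev : cs.wordProd (l true) * cs.simple s = cs.wordProd ((l true).erase s) := by
      have h1 := wordProd_eq_simple_mul_erase cs hs (hcomm true)
      have h2 : Commute (cs.simple s) (cs.wordProd ((l true).erase s)) := by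
        refine Commute.list_prod_right _ _ fun x hx => ?_
        obtain ⟨a, ha, rfl⟩ := List.mem_map.mp hx
        exact hcomm true s hs a (List.mem_of_mem_erase ha)
      rw [h1, h2.eq, mul_assoc, cs.simple_mul_simple_self, mul_one]
    rw [hrev, ← cs.wordProd_append]
    have hnd' : ((l true).erase s ++ l false).Nodup :=
      List.nodup_append'.mpr ⟨(hl.nodup _).erase _, hl.nodup _,
        fun a ha ha' => hdisj a ha' (List.mem_of_mem_erase ha)⟩
    refine isConj_wordProd_of_perm cs hnd' ((List.perm_ext_iff_of_nodup hnd' hnd).mpr fun a => ?_)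
    rw [List.mem_append, (hl.nodup _).mem_erase_iff, hmem]
    have := hcov a
    have h2 : a = s → a ∉ l false := fun h h' => hdisj s (h ▸ h') hs
    tauto

/-- Counting the first factor of a bipartite Coxeter element by its orbit under conjugation. -/
theorem two_mul_sum_reflections [Fintype W] [DecidableEq W] {ε : B → Bool}
    (hε : ∀ a b, a ≠ b → coxGram M a b ≠ 0 → ε a ≠ ε b) {l : Bool → List B}
    (hl : IsBipartiteCover ε Set.univ l) (l' : B → List B)
    (hnd : ∀ s, (l' s).Nodup) (hmem : ∀ s a, a ∈ l' s ↔ a ∈ coxComponent cs s)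
    (F : W → ℕ) (hF : ∀ g w, F (g * w * g⁻¹) = F w) :
    2 * ∑ t with absLength (simpleSet cs) t = 1,
        F (t⁻¹ * (cs.wordProd (l false) * cs.wordProd (l true))) =
      ∑ s, orderOf (cs.wordProd (l' s)) *
        F (cs.simple s * (cs.wordProd (l false) * cs.wordProd (l true))) := by
  set c := cs.wordProd (l false) * cs.wordProd (l true) with hc
  have hT := (reflectionsGenerate_simpleSet cs).absLength_eq_one_iff (not_isReflectionOf_one cs)
  have h1 : ∀ t ∈ Finset.univ.filter fun t => absLength (simpleSet cs) t = 1,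
      2 * F (t⁻¹ * c) = ∑ s, ∑ k ∈ Finset.range (orderOf (cs.wordProd (l' s))),
        if t = (c ^ k)⁻¹ * cs.simple s * c ^ k then F (cs.simple s * c) else 0 := by
    intro t ht
    have ht' : IsReflectionOf (simpleSet cs) t := (hT t).mp (Finset.mem_filter.mp ht).2
    rw [← sum_card_conj_eq_two cs hε hl l' hnd hmem ht', Finset.sum_mul]
    refine Finset.sum_congr rfl fun s _ => ?_
    rw [Finset.card_filter, Finset.sum_mul]
    refine Finset.sum_congr rfl fun k _ => ?_
    rw [← hc, ite_mul, one_mul, zero_mul]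
    have hiff : c ^ k * t * (c ^ k)⁻¹ = cs.simple s ↔ t = (c ^ k)⁻¹ * cs.simple s * c ^ k := by
      rw [mul_inv_eq_iff_eq_mul, ← eq_inv_mul_iff_mul_eq, mul_assoc]
    by_cases h : t = (c ^ k)⁻¹ * cs.simple s * c ^ k
    · rw [if_pos (hiff.mpr h), if_pos h, ht'.inv_eq cs, ← hF (c ^ k), ← hiff.mpr h]
      congr 1
      have : Commute c (c ^ k)⁻¹ := ((Commute.refl c).pow_right k).inv_right
      rw [mul_assoc (c ^ k), mul_assoc t, this.eq]
      group
    · rw [if_neg (fun h' => h (hiff.mp h')), if_neg h]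
  rw [Finset.mul_sum, Finset.sum_congr rfl h1, Finset.sum_comm]
  refine Finset.sum_congr rfl fun s _ => ?_
  rw [Finset.sum_comm]
  refine (Finset.sum_eq_card_nsmul (b := F (cs.simple s * c)) fun k _ => ?_).trans
    (by rw [Finset.card_range, smul_eq_mul])
  rw [Finset.sum_ite_eq', if_pos]
  rw [Finset.mem_filter, hT]
  exact ⟨Finset.mem_univ _, by simpa using (isReflectionOf_simple cs s).conj (c ^ k)⁻¹⟩

theorem exists_wordProd_eq_coxeterElement [Finite W] {c : W}
    (hc : IsCoxeterElementOf (simpleSet cs) c) :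
    ∃ l : List B, l.Nodup ∧ (∀ a, a ∈ l) ∧ cs.wordProd l = c := by
  obtain ⟨L, hL, hmem, rfl⟩ := hc
  obtain ⟨l, rfl⟩ : ∃ l : List B, l.map cs.simple = L := by
    have : L ∈ Set.range (List.map cs.simple) := by
      rw [Set.range_list_map]
      exact fun x hx => (hmem x).mp hx
    exact this
  refine ⟨l, List.Nodup.of_map _ hL, fun a => ?_, rfl⟩
  rw [← List.mem_map_of_injective (simple_injective cs), hmem]
  exact ⟨a, rfl⟩

theorem exists_wordProd_eq_coxeterElement_component [Finite W] {s : B}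
    {x : componentSubgroup cs s} (hx : IsCoxeterElementOf (componentGens cs s) x) :
    ∃ l : List B, l.Nodup ∧ (∀ a, a ∈ l ↔ a ∈ coxComponent cs s) ∧ cs.wordProd l = x :=
  exists_wordProd_eq_of_isCoxeterElementOf cs _ (coxComponent cs s)
    (fun a ha => Subgroup.subset_closure ⟨a, ha, rfl⟩) hx (simple_injective cs)

theorem exists_wordProd_eq_coxeterElement_parabolic [Finite W] {s : B}
    {x : parabolic cs s} (hx : IsCoxeterElementOf (parabolicGens cs s) x) :
    ∃ l : List B, l.Nodup ∧ (∀ a, a ∈ l ↔ a ≠ s) ∧ cs.wordProd l = x := by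
  refine exists_wordProd_eq_of_isCoxeterElementOf cs _ {a | a ≠ s}
    (fun a ha => simple_mem_parabolic cs ha) ?_ (simple_injective cs)
  convert hx using 1
  ext y
  constructor
  · rintro ⟨a, ha, e⟩
    exact ⟨⟨a, e⟩, fun h => ha (simple_injective cs (e.trans h))⟩
  · rintro ⟨⟨a, e⟩, h⟩
    exact ⟨a, fun ha => h (by rw [← e, ha]; rfl), e⟩

end ChainCount

/-- **Theorem (Stembridge's uniform version of the chain recursion).**
For a finite, not necessarily irreducible, Coxeter system `(W,S)` of rank `n`, letting
`h_s` be the Coxeter number of the irreducible component of `W` containing `s` (the order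
of a Coxeter element `cc s` of that component), and `(j₁,…,j_{k+1})` a sequence of
nonnegative integers summing to `n` with `j_i = 1`:
`2·C_{(j₁,…,j_{k+1})}(W) = ∑_{s∈S} h_s · C_{(j₁,…,ĵᵢ,…,j_{k+1})}(W_⟨s⟩)`. -/
theorem chain_count_recursion_reducible
    {B : Type} [Fintype B] {W : Type} [Group W] [Fintype W]
    {M : CoxeterMatrix B} (cs : CoxeterSystem M W)
    (c : W) (hc : IsCoxeterElementOf (simpleSet cs) c)
    (cc : ∀ s : B, componentSubgroup cs s)
    (hcc : ∀ s : B, IsCoxeterElementOf (componentGens cs s) (cc s))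
    {k : ℕ} (j : Fin (k + 1) → ℕ) (hsum : ∑ t, j t = Fintype.card B)
    (i : Fin (k + 1)) (hji : j i = 1)
    (c' : ∀ s : B, parabolic cs s)
    (hc' : ∀ s : B, IsCoxeterElementOf (parabolicGens cs s) (c' s)) :
    2 * chainCount (simpleSet cs) c j =
      ∑ s : B, orderOf (cc s) * chainCount (parabolicGens cs s) (c' s) (j ∘ i.succAbove) := by
  classical
  obtain ⟨lc, hlc, hlc_all, rfl⟩ := exists_wordProd_eq_coxeterElement cs hc
  choose l' hnd hmem hl' using fun s => exists_wordProd_eq_coxeterElement_component cs (hcc s)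
  choose lp hpnd hpmem hlp using fun s => exists_wordProd_eq_coxeterElement_parabolic cs (hc' s)
  obtain ⟨ε, hε⟩ := exists_coloring cs
  obtain ⟨l, hl, -⟩ := exists_isBipartiteCover ε (Set.univ : Set B)
  have hconj := absLength_conj (simpleSet cs)
  have hsum' : ∑ t, (j ∘ i.succAbove) t + 1 = Fintype.card B := by
    rw [← hsum, Fin.sum_univ_succAbove j i, hji, add_comm]
    rfl
  have hbip : IsConj (cs.wordProd lc) (cs.wordProd (l false) * cs.wordProd (l true)) := by
    rw [← cs.wordProd_append]
    refine isConj_wordProd_of_perm cs hlc ?_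
    have hnd₀ : (l false ++ l true).Nodup := by
      refine List.nodup_append'.mpr ⟨hl.nodup _, hl.nodup _, fun b hb hb' => ?_⟩
      have := hl.color _ b hb
      rw [hl.color _ b hb'] at this
      simp at this
    refine (List.perm_ext_iff_of_nodup hlc hnd₀).mpr fun b => ?_
    have := hl.mem b (Set.mem_univ b)
    simp only [hlc_all, List.mem_append, true_iff]
    cases h : ε b <;> rw [h] at this <;> tauto
  rw [(reflectionsGenerate_simpleSet cs).chainCount_eq_factCount j
      (by rw [hsum, absLength_wordProd_eq_card cs hlc hlc_all]),
    factCount_eq_of_isConj hconj j hbip, factCount_eq_sum_succAbove hconj j i, hji,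
    two_mul_sum_reflections cs hε hl l' hnd hmem _ (factCount_conj hconj _)]
  refine Finset.sum_congr rfl fun s _ => ?_
  rw [hl', Subgroup.orderOf_coe, chainCount_parabolicGens cs (hpnd s) (hpmem s) (hlp s) _ hsum',
    factCount_eq_of_isConj hconj _ (hl.isConj_simple_mul cs hε (hpnd s) (hpmem s))]
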